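/- arXiv:1704.04001 — 9 statements merged into one kernel-verified Lean document; each statement's English description precedes it below -/
import Mathlib

section
/- Comparison principle for the one-dimensional Kirchhoff junction problem: assume each Hamiltonian H_i : ℝ × (-∞,0] × [0,T] → ℝ is continuous, coercive in its first argument p uniformly in (x,t), uniformly continuous in (p,x,t) on sets where p is bounded, and Lipschitz continuous in t. If u = (u_1,…,u_K) is a bounded uniformly continuous generalized viscosity subsolution and v = (v_1,…,v_K) is a bounded uniformly continuous generalized viscosity supersolution of the Kirchhoff junction problem with the same constant B, and u_i(·,0) ≤ v_i(·,0) on (-∞,0] for every i ∈ {1,…,K}, then u_i ≤ v_i on (-∞,0] × [0,T] for every i ∈ {1,…,K}. -/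
open Set Filter

/-- The (branchwise) space-time domain of the junction problem: one branch is a copy
of `(-∞,0]`, and time ranges over `[0,T]`. -/
def JDom (T : ℝ) : Set (ℝ × ℝ) := {q : ℝ × ℝ | q.1 ≤ 0 ∧ q.2 ∈ Set.Icc 0 T}

/-- Minimum of a real-valued family over `Fin K`, `K ≥ 1`. -/
noncomputable def jmin {K : ℕ} (hK : 0 < K) (f : Fin K → ℝ) : ℝ :=
  Finset.univ.inf' ⟨⟨0, hK⟩, Finset.mem_univ _⟩ f

/-- Maximum of a real-valued family over `Fin K`, `K ≥ 1`. -/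
noncomputable def jmax {K : ℕ} (hK : 0 < K) (f : Fin K → ℝ) : ℝ :=
  Finset.univ.sup' ⟨⟨0, hK⟩, Finset.mem_univ _⟩ f

/-- `(p₁,…,p_K, a)` belongs to the superjet `J⁺u(0,t₀)` of `u` at the junction point:
for every branch `i`, `u_i(x,t) ≤ u_i(0,t₀) + p_i x + a (t−t₀) + o(|x| + |t−t₀|)`
as `(x,t) → (0,t₀)` in `(-∞,0] × [0,T]`. -/
def JunctionSuperjet (K : ℕ) (T : ℝ) (u : Fin K → ℝ → ℝ → ℝ) (t₀ : ℝ)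
    (p : Fin K → ℝ) (a : ℝ) : Prop :=
  ∀ i : Fin K, ∀ ε > (0 : ℝ), ∃ δ > (0 : ℝ), ∀ x t : ℝ, x ≤ 0 → t ∈ Set.Icc 0 T →
    |x| + |t - t₀| < δ →
    u i x t ≤ u i 0 t₀ + p i * x + a * (t - t₀) + ε * (|x| + |t - t₀|)

/-- `(q₁,…,q_K, b)` belongs to the subjet `J⁻v(0,t₀)` of `v` at the junction point. -/
def JunctionSubjet (K : ℕ) (T : ℝ) (v : Fin K → ℝ → ℝ → ℝ) (t₀ : ℝ)
    (q : Fin K → ℝ) (b : ℝ) : Prop :=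
  ∀ i : Fin K, ∀ ε > (0 : ℝ), ∃ δ > (0 : ℝ), ∀ x t : ℝ, x ≤ 0 → t ∈ Set.Icc 0 T →
    |x| + |t - t₀| < δ →
    v i x t ≥ v i 0 t₀ + q i * x + b * (t - t₀) - ε * (|x| + |t - t₀|)

/-- `w` is a viscosity subsolution of `∂ₜw + H(∂ₓw, x, t) = 0` in `(-∞,0) × (0,T]`:
whenever `φ` is `C¹` and `w − φ` attains a local maximum (relative to the domain)
at `(x₀,t₀)` with `x₀ < 0`, `0 < t₀ ≤ T`, then
`∂ₜφ(x₀,t₀) + H(∂ₓφ(x₀,t₀), x₀, t₀) ≤ 0`. -/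
def ViscSubIn (T : ℝ) (H : ℝ → ℝ → ℝ → ℝ) (w : ℝ → ℝ → ℝ) : Prop :=
  ∀ (φ : ℝ × ℝ → ℝ) (x₀ t₀ : ℝ), x₀ < 0 → 0 < t₀ → t₀ ≤ T → ContDiff ℝ 1 φ →
    (∀ᶠ q in nhdsWithin (x₀, t₀) (JDom T), w q.1 q.2 - φ q ≤ w x₀ t₀ - φ (x₀, t₀)) →
    fderiv ℝ φ (x₀, t₀) ((0 : ℝ), (1 : ℝ)) +
      H (fderiv ℝ φ (x₀, t₀) ((1 : ℝ), (0 : ℝ))) x₀ t₀ ≤ 0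

/-- `w` is a viscosity supersolution of `∂ₜw + H(∂ₓw, x, t) = 0` in `(-∞,0) × (0,T]`. -/
def ViscSuperIn (T : ℝ) (H : ℝ → ℝ → ℝ → ℝ) (w : ℝ → ℝ → ℝ) : Prop :=
  ∀ (φ : ℝ × ℝ → ℝ) (x₀ t₀ : ℝ), x₀ < 0 → 0 < t₀ → t₀ ≤ T → ContDiff ℝ 1 φ →
    (∀ᶠ q in nhdsWithin (x₀, t₀) (JDom T), w q.1 q.2 - φ q ≥ w x₀ t₀ - φ (x₀, t₀)) →
    fderiv ℝ φ (x₀, t₀) ((0 : ℝ), (1 : ℝ)) +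
      H (fderiv ℝ φ (x₀, t₀) ((1 : ℝ), (0 : ℝ))) x₀ t₀ ≥ 0

/-- `u` is a generalized viscosity subsolution of the Kirchhoff junction problem:
each `u_i` is a viscosity subsolution in the interior of its branch, and at the
junction, for every `(p,a) ∈ J⁺u(0,t₀)`,
`min(Σ_i p_i − B, min_i (a + H_i(p_i, 0, t₀))) ≤ 0`. -/
def KirchhoffSubsolution {K : ℕ} (hK : 0 < K) (T B : ℝ)
    (H : Fin K → ℝ → ℝ → ℝ → ℝ) (u : Fin K → ℝ → ℝ → ℝ) : Prop :=
  (∀ i, ViscSubIn T (H i) (u i)) ∧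
  ∀ t₀ ∈ Set.Ioc 0 T, ∀ (p : Fin K → ℝ) (a : ℝ),
    JunctionSuperjet K T u t₀ p a →
    min ((∑ i, p i) - B) (jmin hK fun i => a + H i (p i) 0 t₀) ≤ 0

/-- `v` is a generalized viscosity supersolution of the Kirchhoff junction problem:
each `v_i` is a viscosity supersolution in the interior of its branch, and at the
junction, for every `(q,b) ∈ J⁻v(0,t₀)`,
`max(Σ_i q_i − B, max_i (b + H_i(q_i, 0, t₀))) ≥ 0`. -/
def KirchhoffSupersolution {K : ℕ} (hK : 0 < K) (T B : ℝ)
    (H : Fin K → ℝ → ℝ → ℝ → ℝ) (v : Fin K → ℝ → ℝ → ℝ) : Prop :=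
  (∀ i, ViscSuperIn T (H i) (v i)) ∧
  ∀ t₀ ∈ Set.Ioc 0 T, ∀ (q : Fin K → ℝ) (b : ℝ),
    JunctionSubjet K T v t₀ q b →
    max ((∑ i, q i) - B) (jmax hK fun i => b + H i (q i) 0 t₀) ≥ 0

open scoped Topology
/-- `f` is touched from above at `x` by a parabola of slope `m`. -/
def TouchedAbove (f : ℝ → ℝ) (m x : ℝ) : Prop :=
  ∃ γ : ℝ, IsLocalMax (fun y => f y - (m * (y - x) + γ * (y - x) ^ 2)) x

lemma exists_touchedAbove {f : ℝ → ℝ} (hf : Continuous f) {a b y : ℝ} (β γ : ℝ)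
    (hy : y ∈ Ioo a b)
    (ha : f a - (β * a + γ * a ^ 2) ≤ f y - (β * y + γ * y ^ 2))
    (hb : f b - (β * b + γ * b ^ 2) ≤ f y - (β * y + γ * y ^ 2)) :
    ∃ z ∈ Ioo a b, TouchedAbove f (β + 2 * γ * z) z := by
  set F : ℝ → ℝ := fun y => f y - (β * y + γ * y ^ 2) with hF
  have hFc : Continuous F := by fun_prop
  obtain ⟨z, hz, hmax⟩ := (isCompact_Icc (a := a) (b := b)).exists_isMaxOn
    ⟨y, Ioo_subset_Icc_self hy⟩ hFc.continuousOn
  have key : ∃ z ∈ Ioo a b, IsMaxOn F (Icc a b) z := by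
    by_cases hzI : z ∈ Ioo a b
    · exact ⟨z, hzI, hmax⟩
    · refine ⟨y, hy, fun x hx => show F x ≤ F y from le_trans (hmax hx) ?_⟩
      rcases eq_or_lt_of_le hz.1 with h | h
      · rw [← h]; exact ha
      · rcases eq_or_lt_of_le hz.2 with h' | h'
        · rw [h']; exact hb
        · exact absurd ⟨h, h'⟩ hzI
  obtain ⟨z, hz, hmax⟩ := key
  refine ⟨z, hz, γ, ?_⟩
  filter_upwards [hmax.isLocalMax (Icc_mem_nhds hz.1 hz.2)] with x hx
  simp only [hF] at hx
  nlinarith [hx]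

/-- If no line of slope `r` touches `f` from above just left of `0`, then `f` lies strictly on
one side of the line of slope `r` there. -/
lemma eventually_lt_or_gt {f : ℝ → ℝ} (hf : Continuous f) (h0 : f 0 = 0) {r : ℝ}
    (hno : ∀ᶠ x in 𝓝[<] (0 : ℝ), ¬ TouchedAbove f r x) :
    (∀ᶠ x in 𝓝[<] (0 : ℝ), f x < r * x) ∨ (∀ᶠ x in 𝓝[<] (0 : ℝ), r * x < f x) := by
  by_contra! hcon
  obtain ⟨h1, h2⟩ := hcon
  obtain ⟨l, hl, hlno⟩ := mem_nhdsLT_iff_exists_Ioo_subset.1 hno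
  obtain ⟨x₁, hx₁, hx₁l⟩ := (h2.and_eventually (Ioo_mem_nhdsLT hl)).exists
  obtain ⟨x₂, hx₂, hx₂l⟩ := (h1.and_eventually (Ioo_mem_nhdsLT hx₁l.2)).exists
  obtain ⟨z, hz, ht⟩ := exists_touchedAbove hf r 0 hx₂l (by linarith) (by rw [h0]; linarith)
  exact hlno (show z ∈ Ioo l 0 from ⟨hx₁l.1.trans hz.1, hz.2⟩) (by simpa using ht)

lemma touch_at_critical_slope {f : ℝ → ℝ} (hf : Continuous f) (h0 : f 0 = 0) {p : ℝ}
    (hp : IsLUB {r : ℝ | ∀ᶠ x in 𝓝[<] (0 : ℝ), f x ≤ r * x} p) :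
    ¬ ∀ᶠ q in 𝓝[<] (0 : ℝ) ×ˢ 𝓝 p, ¬ TouchedAbove f q.2 q.1 := by
  intro hno
  obtain ⟨P, hP, Q, hQ, hPQ⟩ := eventually_prod_iff.1 hno
  obtain ⟨l, hl, hlP⟩ := mem_nhdsLT_iff_exists_Ioo_subset.1 hP
  obtain ⟨c, hc, hcQ⟩ := Metric.eventually_nhds_iff.1 hQ
  have hup : ∀ᶠ x in 𝓝[<] (0 : ℝ), (p + c / 16) * x < f x := by
    have hn : ∀ᶠ x in 𝓝[<] (0 : ℝ), ¬ TouchedAbove f (p + c / 16) x := by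
      filter_upwards [hP] with x hx
      refine hPQ hx (hcQ ?_)
      rw [Real.dist_eq, abs_lt]; constructor <;> linarith
    rcases eventually_lt_or_gt hf h0 hn with h | h
    · have := hp.1 (show p + c / 16 ∈ _ from h.mono fun x hx => hx.le)
      linarith
    · exact h
  have hlow : ∀ᶠ x in 𝓝[<] (0 : ℝ), f x ≤ (p - c / 16) * x := by
    obtain ⟨r, hr, hr'⟩ := (lt_isLUB_iff hp).1 (show p - c / 16 < p by linarith)
    filter_upwards [hr, self_mem_nhdsWithin] with x hx (hx0 : x < 0)
    nlinarith
  obtain ⟨l', hl', hl'P⟩ := mem_nhdsLT_iff_exists_Ioo_subset.1 (hup.and hlow)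
  set ρ : ℝ := - max l l' / 4 with hρ
  have hm : max l l' < 0 := max_lt hl hl'
  have hρ0 : 0 < ρ := by rw [hρ]; linarith
  have hlρ : l < - 2 * ρ := by rw [hρ]; linarith [le_max_left l l']
  have hlρ' : l' < - 2 * ρ := by rw [hρ]; linarith [le_max_right l l']
  obtain ⟨h1, h2⟩ := hl'P (show -ρ ∈ Ioo l' 0 from ⟨by linarith, by linarith⟩)
  obtain ⟨h3, h4⟩ := hl'P (show -2 * ρ ∈ Ioo l' 0 from ⟨by linarith, by linarith⟩)
  have e : c / (4 * ρ) * ρ = c / 4 := by field_simp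
  have e2 : c / (4 * ρ) * ρ ^ 2 = c / 4 * ρ := by rw [pow_two, ← mul_assoc, e]
  obtain ⟨z, hz, ht⟩ := exists_touchedAbove hf (a := -2 * ρ) (b := 0) (y := -ρ)
    (p + c / 2) (c / (4 * ρ)) ⟨by linarith, by linarith⟩
    (by nlinarith) (by rw [h0]; nlinarith)
  refine hPQ (hlP (show z ∈ Ioo l 0 from ⟨by linarith [hz.1], hz.2⟩)) (hcQ ?_) ht
  have hpos : 0 < c / (4 * ρ) := by positivity
  rw [Real.dist_eq, abs_lt]
  constructor <;> nlinarith [mul_lt_mul_of_pos_left hz.1 hpos, mul_lt_mul_of_pos_left hz.2 hpos]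

lemma lower_bound_of_steep {f : ℝ → ℝ} (hf : Continuous f) (h0 : f 0 = 0) {R : ℝ}
    (hst : ∀ᶠ x in 𝓝[<] (0 : ℝ), ∀ m, R ≤ m → ¬ TouchedAbove f m x) :
    ∀ᶠ x in 𝓝[<] (0 : ℝ), R * x ≤ f x := by
  obtain ⟨l, hl, hlS⟩ := mem_nhdsLT_iff_exists_Ioo_subset.1 hst
  filter_upwards [Ioo_mem_nhdsLT hl] with y hy
  have := image_le_of_liminf_slope_right_le_deriv_boundary (f := f) (a := y) (b := 0)
    hf.continuousOn (B := fun x => f y + R * (x - y)) (B' := fun _ => R) (by simp)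
    (by fun_prop)
    (fun x _ => by
      have := (((hasDerivAt_id' x).sub_const y).const_mul R).const_add (f y)
      rw [mul_one] at this
      exact this.hasDerivWithinAt)
    (by
      intro x hx r hr
      by_contra hcon
      have hcon' : ∀ᶠ z in 𝓝[>] x, r ≤ slope f x z :=
        (not_frequently.1 hcon).mono fun z hz => not_lt.1 hz
      obtain ⟨C, hC0, hC⟩ : ∃ C : ℝ, 0 < C ∧ f 0 - R * 0 - C * (0 - x) ^ 2 < f x - R * x := by
        have hx2 : 0 < (0 - x) ^ 2 := by nlinarith [hx.2]
        refine ⟨(|f 0 - (f x - R * x)| + 1) / (0 - x) ^ 2, by positivity, ?_⟩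
        rw [div_mul_cancel₀ _ hx2.ne']
        linarith [le_abs_self (f 0 - (f x - R * x))]
      have hsm : x < min 0 (x + (r - R) / C) :=
        lt_min hx.2 (by have : 0 < (r - R) / C := div_pos (by linarith) hC0
                        linarith)
      obtain ⟨z, hz, hzI⟩ := (hcon'.and (Ioo_mem_nhdsGT hsm)).exists
      have hz0 : z < 0 := hzI.2.trans_le (min_le_left _ _)
      have hzC : (z - x) * C ≤ r - R := by
        have : z < x + (r - R) / C := hzI.2.trans_le (min_le_right _ _)
        have : z - x < (r - R) / C := by linarith
        exact ((lt_div_iff₀ hC0).1 this).le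
      have hzx : 0 < z - x := by linarith [hzI.1]
      rw [slope_def_field, le_div_iff₀ hzx] at hz
      obtain ⟨w, hw, ht⟩ := exists_touchedAbove hf (a := x) (b := 0) (y := z)
        (R - 2 * C * x) C ⟨hzI.1, hz0⟩ (by nlinarith) (by nlinarith)
      refine hlS (show w ∈ Ioo l 0 from ⟨by linarith [hw.1, hx.1, hy.1], hw.2⟩) _ ?_ ht
      nlinarith [hw.1]) (show (0 : ℝ) ∈ Icc y 0 from ⟨hy.2.le, le_rfl⟩)
  rw [h0] at this
  linarith

lemma upper_bound_of_steep {f : ℝ → ℝ} (hf : Continuous f) (h0 : f 0 = 0) {R : ℝ}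
    (hst : ∀ᶠ x in 𝓝[<] (0 : ℝ), ∀ m, m ≤ -R → ¬ TouchedAbove f m x) :
    ∃ r, ∀ᶠ x in 𝓝[<] (0 : ℝ), f x ≤ r * x := by
  obtain ⟨l, hl, hlS⟩ := mem_nhdsLT_iff_exists_Ioo_subset.1 hst
  have hl0 : l < 0 := hl
  set b := l / 2 with hb
  have hb0 : b < 0 := by rw [hb]; linarith
  refine ⟨min (-R) (f b / b), ?_⟩
  filter_upwards [Ioo_mem_nhdsLT hb0] with y hy
  by_contra! hcon
  have : f b ≤ min (-R) (f b / b) * b := by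
    have h1 : f b / b * b = f b := div_mul_cancel₀ _ hb0.ne
    have h2 := min_le_right (-R) (f b / b)
    nlinarith
  obtain ⟨z, hz, ht⟩ := exists_touchedAbove hf (min (-R) (f b / b)) 0 hy
    (by linarith) (by rw [h0]; linarith)
  exact hlS (show z ∈ Ioo l 0 from ⟨by linarith [hz.1], hz.2⟩) _ (min_le_left _ _)
    (by simpa using ht)

/-- Two functions `f₁`, `f₂` with `f₁ + f₂ ≤ 0 = f₁ 0 = f₂ 0`, neither of which can be touched
from above near `0` with slopes where `g₁`, respectively `g₂`, is positive, are separated on the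
left of `0` by a nondegenerate interval of lines. -/
lemma exists_separating_slopes {f₁ f₂ g₁ g₂ : ℝ → ℝ} (hf₁ : Continuous f₁) (hf₂ : Continuous f₂)
    (h₁0 : f₁ 0 = 0) (h₂0 : f₂ 0 = 0) (hle : ∀ᶠ x in 𝓝[<] (0 : ℝ), f₁ x + f₂ x ≤ 0)
    (hg₁ : Continuous g₁) {c R : ℝ} (hc : 0 < c)
    (hgg : ∀ p, g₁ p < c → 0 < g₂ (-p)) (hR : ∀ p, R ≤ |p| → c ≤ g₁ p)
    (hN₁ : ∀ r, 0 < g₁ r → ∀ᶠ q in 𝓝[<] (0 : ℝ) ×ˢ 𝓝 r, ¬ TouchedAbove f₁ q.2 q.1)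
    (hN₂ : ∀ r, 0 < g₂ r → ∀ᶠ q in 𝓝[<] (0 : ℝ) ×ˢ 𝓝 r, ¬ TouchedAbove f₂ q.2 q.1)
    (hst : ∀ᶠ x in 𝓝[<] (0 : ℝ), ∀ m, R ≤ |m| → ¬ TouchedAbove f₁ m x) :
    ∃ r r', r < r' ∧ ∀ s ∈ Icc r r', 0 < g₁ s ∧ g₁ s < c ∧
      (∀ᶠ x in 𝓝[<] (0 : ℝ), f₁ x ≤ s * x) ∧ (∀ᶠ x in 𝓝[<] (0 : ℝ), f₂ x ≤ -s * x) := by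
  set A₁ : Set ℝ := {r : ℝ | ∀ᶠ x in 𝓝[<] (0 : ℝ), f₁ x ≤ r * x} with hA₁
  set A₂ : Set ℝ := {r : ℝ | ∀ᶠ x in 𝓝[<] (0 : ℝ), f₂ x ≤ r * x} with hA₂
  have hdown : ∀ (f : ℝ → ℝ) (r r' : ℝ), r' ≤ r → (∀ᶠ x in 𝓝[<] (0 : ℝ), f x ≤ r * x) →
      ∀ᶠ x in 𝓝[<] (0 : ℝ), f x ≤ r' * x := by
    intro f r r' hrr h
    filter_upwards [h, self_mem_nhdsWithin] with x hx (hx0 : x < 0)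
    nlinarith
  have hslope : ∀ r, 0 < g₁ r → ∀ᶠ x in 𝓝[<] (0 : ℝ), ¬ TouchedAbove f₁ r x := fun r hr =>
    (hN₁ r hr).curry.mono fun x hx => hx.self_of_nhds
  have hlow := lower_bound_of_steep hf₁ h₁0
    (hst.mono fun x hx m hm => hx m (hm.trans (le_abs_self m)))
  have hne : A₁.Nonempty := upper_bound_of_steep hf₁ h₁0 (R := R)
    (hst.mono fun x hx m hm => hx m ((by linarith : R ≤ -m).trans (neg_le_abs m)))
  have hbdd : BddAbove A₁ := by
    refine ⟨R, fun r hr => ?_⟩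
    obtain ⟨x, ⟨hx1, hx2⟩, (hx0 : x < 0)⟩ :=
      ((hlow.and hr).and self_mem_nhdsWithin).exists
    by_contra! h
    nlinarith
  set p := sSup A₁ with hp
  have hlub : IsLUB A₁ p := isLUB_csSup hne hbdd
  have hgp : g₁ p ≤ 0 := by
    by_contra! h
    exact touch_at_critical_slope hf₁ h₁0 hlub (hN₁ p h)
  have hne₂ : -R ∈ A₂ := by
    filter_upwards [hlow, hle] with x hx hx'
    linarith
  obtain ⟨l, hlp, hgl, hlA⟩ : ∃ l, l < p ∧ c ≤ g₁ l ∧ ∀ s, l < s → -s ∈ A₂ := by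
    by_cases hb₂ : BddAbove A₂
    · set q := sSup A₂ with hq
      have hlub₂ : IsLUB A₂ q := isLUB_csSup ⟨_, hne₂⟩ hb₂
      have hgq : c ≤ g₁ (-q) := by
        by_contra! h
        have := hgg _ h
        rw [neg_neg] at this
        exact touch_at_critical_slope hf₂ h₂0 hlub₂ (hN₂ q this)
      refine ⟨-q, ?_, hgq, fun s hs => ?_⟩
      · by_contra! hpq
        have hpq' : p < -q := lt_of_le_of_ne hpq (by rintro h; rw [← h] at hgq; linarith)
        have hev : ∀ᶠ s in 𝓝 (-q), 0 < g₁ s ∧ p < s :=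
          (hg₁.continuousAt.eventually (lt_mem_nhds (hc.trans_le hgq))).and (lt_mem_nhds hpq')
        obtain ⟨s, ⟨hs1, hs2⟩, (hs3 : s < -q)⟩ :=
          ((hev.filter_mono nhdsWithin_le_nhds).and
            (self_mem_nhdsWithin (a := -q) (s := Iio (-q)))).exists
        rcases eventually_lt_or_gt hf₁ h₁0 (hslope s hs1) with h | h
        · have := hlub.1 (show s ∈ A₁ from h.mono fun x hx => hx.le)
          linarith
        · have : -s ∈ A₂ := by
            filter_upwards [h, hle] with x hx hx'
            linarith
          have := hlub₂.1 this
          linarith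
      · obtain ⟨r, hr, hr'⟩ := (lt_isLUB_iff hlub₂).1 (show -s < q by linarith)
        exact hdown _ _ _ hr'.le hr
    · refine ⟨min (-|R|) (p - 1), lt_of_le_of_lt (min_le_right _ _) (by linarith), hR _ ?_,
        fun s _ => ?_⟩
      · have h1 := min_le_left (-|R|) (p - 1)
        have h2 := neg_le_abs (min (-|R|) (p - 1))
        linarith [le_abs_self R]
      · obtain ⟨r, hr, hr'⟩ := not_bddAbove_iff.1 hb₂ (-s)
        exact hdown _ _ _ hr'.le hr
  obtain ⟨s, hs, hgs⟩ : c / 2 ∈ g₁ '' Ioo l p := by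
    refine intermediate_value_Ioo' hlp.le hg₁.continuousOn ⟨by linarith, by linarith⟩
  have hev : ∀ᶠ z in 𝓝 s, 0 < g₁ z ∧ g₁ z < c ∧ l < z ∧ z < p := by
    refine (hg₁.continuousAt.eventually (lt_mem_nhds ?_)).and
      ((hg₁.continuousAt.eventually (gt_mem_nhds ?_)).and
        ((lt_mem_nhds hs.1).and (gt_mem_nhds hs.2))) <;> rw [hgs] <;> linarith
  obtain ⟨ε, hε, hball⟩ := Metric.eventually_nhds_iff.1 hev
  refine ⟨s, s + ε / 2, by linarith, fun z hz => ?_⟩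
  obtain ⟨k1, k2, k3, k4⟩ := hball (show dist z s < ε by
    rw [Real.dist_eq, abs_lt]; constructor <;> linarith [hz.1, hz.2])
  obtain ⟨r, hr, hr'⟩ := (lt_isLUB_iff hlub).1 k4
  exact ⟨k1, k2, hdown _ _ _ hr'.le hr, hlA z k3⟩

lemma TouchedAbove.of_affine_comp {W : ℝ → ℝ} {σ x₀ k m y : ℝ} (hσ : σ ^ 2 = 1)
    (h : TouchedAbove (fun y => W (x₀ + σ * y) - k) m y) :
    TouchedAbove W (σ * m) (x₀ + σ * y) := by
  obtain ⟨γ, hγ⟩ := h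
  refine ⟨γ, ?_⟩
  have hy : σ * (x₀ + σ * y - x₀) = y := by linear_combination y * hσ
  have hc : Tendsto (fun z : ℝ => σ * (z - x₀)) (𝓝 (x₀ + σ * y)) (𝓝 y) := by
    have : Continuous fun z : ℝ => σ * (z - x₀) := by fun_prop
    convert this.tendsto (x₀ + σ * y) using 2
    exact hy.symm
  filter_upwards [hc.eventually hγ] with z hz
  have e : x₀ + σ * (σ * (z - x₀)) = z := by linear_combination (z - x₀) * hσ
  rw [e] at hz
  have e2 : γ * (σ * (z - x₀) - y) ^ 2 = γ * (z - (x₀ + σ * y)) ^ 2 := by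
    linear_combination γ * ((z - x₀) ^ 2 - y ^ 2) * hσ
  simp only [sub_self, mul_zero, ne_eq, OfNat.ofNat_ne_zero, not_false_eq_true, zero_pow,
    add_zero, sub_zero] at hz ⊢
  have e3 : m * (σ * (z - x₀) - y) = σ * m * (z - (x₀ + σ * y)) := by
    linear_combination m * y * hσ
  rw [e2, e3] at hz
  linarith

/-- Passing from a test parabola for the time-maximal function `W` to a test function for `w`. -/
lemma ViscSubIn.of_touchedAbove {T : ℝ} {H : ℝ → ℝ → ℝ → ℝ} {w : ℝ → ℝ → ℝ}
    (hw : ViscSubIn T H w) {W : ℝ → ℝ} {x t t₀ a κ m : ℝ} (hx : x < 0) (ht : t ∈ Ioc 0 T)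
    (hle : ∀ x, ∀ t ∈ Icc 0 T, w x t ≤ W x + a * (t - t₀) + κ * (t - t₀) ^ 2)
    (heq : w x t = W x + a * (t - t₀) + κ * (t - t₀) ^ 2) (hm : TouchedAbove W m x) :
    a + 2 * κ * (t - t₀) + H m x t ≤ 0 := by
  obtain ⟨γ, hγ⟩ := hm
  set P : ℝ → ℝ := fun y => m * (y - x) + γ * (y - x) ^ 2 with hP
  set Q : ℝ → ℝ := fun s => a * (s - t₀) + κ * (s - t₀) ^ 2 with hQ
  have hPd : HasDerivAt P m x := by
    have := (((hasDerivAt_id' x).sub_const x).const_mul m).add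
      ((((hasDerivAt_id' x).sub_const x).pow 2).const_mul γ)
    exact HasDerivAt.congr_deriv (f := P) this (by simp)
  have hQd : HasDerivAt Q (a + 2 * κ * (t - t₀)) t := by
    have := (((hasDerivAt_id' t).sub_const t₀).const_mul a).add
      ((((hasDerivAt_id' t).sub_const t₀).pow 2).const_mul κ)
    exact HasDerivAt.congr_deriv (f := Q) this (by norm_num; ring)
  have hφ : HasFDerivAt (fun q : ℝ × ℝ => P q.1 + Q q.2)
      (m • ContinuousLinearMap.fst ℝ ℝ ℝ +
        (a + 2 * κ * (t - t₀)) • ContinuousLinearMap.snd ℝ ℝ ℝ) (x, t) :=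
    (HasDerivAt.comp_hasFDerivAt (x, t) (f := Prod.fst) hPd hasFDerivAt_fst).add
      (HasDerivAt.comp_hasFDerivAt (x, t) (f := Prod.snd) hQd hasFDerivAt_snd)
  have hC : ContDiff ℝ 1 (fun q : ℝ × ℝ => P q.1 + Q q.2) := by
    simp only [hP, hQ]
    fun_prop
  have := hw (fun q => P q.1 + Q q.2) x t hx ht.1 ht.2 hC ?_
  · rw [hφ.fderiv] at this
    simpa using this
  · have hγ' : ∀ᶠ y in 𝓝 x, W y - P y ≤ W x - P x := hγ
    have h1 : ∀ᶠ q : ℝ × ℝ in 𝓝[JDom T] (x, t), W q.1 - P q.1 ≤ W x - P x :=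
      (continuous_fst.tendsto (x, t)).eventually hγ' |>.filter_mono nhdsWithin_le_nhds
    filter_upwards [h1, self_mem_nhdsWithin] with q hq hqd
    have := hle q.1 q.2 hqd.2
    simp only [hQ]
    linarith

/-- Taking, for each `x`, the maximum over time of `w` minus a strictly touching parabola in time
turns a subsolution near `(x₀, t₀)` into a function of `x` that cannot be touched from above with
slopes violating the inequality frozen at `(x₀, t₀)`. -/
lemma ViscSubIn.exists_timeSlice {T : ℝ} {H : ℝ → ℝ → ℝ → ℝ} {w : ℝ → ℝ → ℝ}
    (hsub : ViscSubIn T H w)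
    (hH : ContinuousOn (fun q : ℝ × ℝ × ℝ => H q.1 q.2.1 q.2.2)
      {q : ℝ × ℝ × ℝ | q.2.1 ≤ 0 ∧ q.2.2 ∈ Icc 0 T})
    (hw : Continuous fun q : ℝ × ℝ => w q.1 q.2) {x₀ t₀ a κ : ℝ} (hx₀ : x₀ ≤ 0)
    (ht₀ : t₀ ∈ Ioc 0 T)
    (h : ∀ t ∈ Icc 0 T, w x₀ t ≤ w x₀ t₀ + a * (t - t₀) + κ * (t - t₀) ^ 2) :
    ∃ W : ℝ → ℝ, Continuous W ∧ W x₀ = w x₀ t₀ ∧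
      (∀ x, ∀ t ∈ Icc 0 T, w x t ≤ W x + a * (t - t₀) + (κ + 1) * (t - t₀) ^ 2) ∧
      (∀ x, ∃ t ∈ Icc 0 T, w x t = W x + a * (t - t₀) + (κ + 1) * (t - t₀) ^ 2) ∧
      (∀ r, 0 < a + H r x₀ t₀ →
        ∀ᶠ q in 𝓝 x₀ ×ˢ 𝓝 r, q.1 < 0 → ¬ TouchedAbove W q.2 q.1) ∧
      ∀ R, (∀ p x t, x ≤ 0 → t ∈ Icc 0 T → R ≤ |p| → 1 - a ≤ H p x t) →
        ∀ᶠ x in 𝓝 x₀, x < 0 → ∀ m, R ≤ |m| → ¬ TouchedAbove W m x := by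
  have ht₀' : t₀ ∈ Icc 0 T := Ioc_subset_Icc_self ht₀
  set F : ℝ → ℝ → ℝ := fun x t => w x t - a * (t - t₀) - (κ + 1) * (t - t₀) ^ 2 with hF
  have hFc : Continuous fun q : ℝ × ℝ => F q.1 q.2 := by
    simp only [hF]; fun_prop
  have hFx : ∀ x, ContinuousOn (F x) (Icc 0 T) := fun x =>
    (hFc.comp (Continuous.prodMk_right x)).continuousOn
  set W : ℝ → ℝ := fun x => sSup (F x '' Icc 0 T) with hW
  have hWc : Continuous W := isCompact_Icc.continuous_sSup hFc
  have hub : ∀ x, ∀ t ∈ Icc 0 T, F x t ≤ W x := fun x t ht =>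
    le_csSup (isCompact_Icc.image_of_continuousOn (hFx x)).bddAbove (mem_image_of_mem _ ht)
  have hatt : ∀ x, ∃ t ∈ Icc 0 T, F x t = W x := fun x => by
    obtain ⟨t, ht, he⟩ := isCompact_Icc.exists_sSup_image_eq ⟨t₀, ht₀'⟩ (hFx x)
    exact ⟨t, ht, he.symm⟩
  have hW₀ : W x₀ = w x₀ t₀ := by
    apply le_antisymm
    · obtain ⟨t, ht, he⟩ := hatt x₀
      rw [← he]
      simp only [hF]
      nlinarith [h t ht, sq_nonneg (t - t₀)]
    · simpa [hF] using hub x₀ t₀ ht₀'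
  have hloc : ∀ ε > 0, ∀ᶠ x in 𝓝 x₀, ∀ t ∈ Icc 0 T, F x t = W x → |t - t₀| < ε := by
    intro ε hε
    have hcpt : IsCompact (Icc 0 T ∩ {t | ε ≤ |t - t₀|}) :=
      isCompact_Icc.inter_right (isClosed_le continuous_const (by fun_prop))
    have hev : ∀ᶠ x in 𝓝 x₀, ∀ t ∈ Icc 0 T ∩ {t | ε ≤ |t - t₀|}, F x t < W x := by
      refine hcpt.eventually_forall_of_forall_eventually fun t ht => ?_
      refine ContinuousAt.eventually_lt (f := fun q : ℝ × ℝ => F q.1 q.2)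
        (g := fun q : ℝ × ℝ => W q.1) hFc.continuousAt
        (hWc.comp continuous_fst).continuousAt ?_
      have h1 := h t ht.1
      have h2 : 0 < (t - t₀) ^ 2 := by
        have : 0 < |t - t₀| := hε.trans_le ht.2
        rw [← sq_abs]; positivity
      simp only [hF, hW₀]
      nlinarith
    filter_upwards [hev] with x hx t ht he
    by_contra! hcon
    exact (hx t ⟨ht, hcon⟩).ne he
  have hle : ∀ x, ∀ t ∈ Icc 0 T, w x t ≤ W x + a * (t - t₀) + (κ + 1) * (t - t₀) ^ 2 :=
    fun x t ht => by have := hub x t ht; simp only [hF] at this; linarith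
  have heq : ∀ {x t}, F x t = W x → w x t = W x + a * (t - t₀) + (κ + 1) * (t - t₀) ^ 2 :=
    fun {x t} he => by simp only [hF] at he; linarith
  have htouch : ∀ {x t m}, x < 0 → t ∈ Icc 0 T → |t - t₀| < t₀ → F x t = W x →
      TouchedAbove W m x → a + 2 * (κ + 1) * (t - t₀) + H m x t ≤ 0 :=
    fun {x t m} hx ht hlt he hm =>
      hsub.of_touchedAbove hx ⟨by linarith [(abs_lt.1 hlt).1], ht.2⟩ hle (heq he) hm
  refine ⟨W, hWc, hW₀, hle, fun x => ?_, fun r hr => ?_, fun R hR => ?_⟩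
  · obtain ⟨t, ht, he⟩ := hatt x
    exact ⟨t, ht, heq he⟩
  · set G : ℝ × ℝ × ℝ → ℝ :=
      fun q => a + 2 * (κ + 1) * (q.2.2 - t₀) + H q.1 q.2.1 q.2.2 with hG
    have hGc : ContinuousWithinAt G {q : ℝ × ℝ × ℝ | q.2.1 ≤ 0 ∧ q.2.2 ∈ Icc 0 T}
        (r, x₀, t₀) :=
      ContinuousWithinAt.add (by fun_prop) (hH (r, x₀, t₀) ⟨hx₀, ht₀'⟩)
    have hpos : 0 < G (r, x₀, t₀) := by simpa [hG] using hr
    obtain ⟨δ, hδ, hball⟩ := Metric.mem_nhdsWithin_iff.1 (hGc.eventually (lt_mem_nhds hpos))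
    have hdist : ∀ y : ℝ, ∀ᶠ x in 𝓝 y, dist x y < δ := fun y => Metric.ball_mem_nhds y hδ
    filter_upwards [((hdist x₀).and (hloc _ (lt_min hδ ht₀.1))).prod_mk (hdist r)]
      with q hq hq0 hm
    obtain ⟨t, ht, he⟩ := hatt q.1
    have ht' := hq.1.2 t ht he
    have hneg := htouch hq0 ht (ht'.trans_le (min_le_right _ _)) he hm
    have hmem := hball (show (q.2, q.1, t) ∈ _ from
      ⟨by
        rw [Metric.mem_ball, Prod.dist_eq, Prod.dist_eq]
        exact max_lt hq.2 (max_lt hq.1.1 (ht'.trans_le (min_le_left _ _))), hq0.le, ht⟩)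
    exact absurd hneg (not_le.2 hmem)
  · have hε : 0 < min t₀ (1 / (2 * |κ + 1| + 1)) := lt_min ht₀.1 (by positivity)
    filter_upwards [hloc _ hε] with x hx hx0 m hm hmt
    obtain ⟨t, ht, he⟩ := hatt x
    have ht' := hx t ht he
    have hneg := htouch hx0 ht (ht'.trans_le (min_le_left _ _)) he hmt
    have h1 := hR m x t hx0.le ht hm
    have h2 : |t - t₀| * (2 * |κ + 1| + 1) < 1 :=
      (lt_div_iff₀ (by positivity)).1 (ht'.trans_le (min_le_right _ _))
    have h3 : |2 * (κ + 1) * (t - t₀)| = 2 * |κ + 1| * |t - t₀| := by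
      rw [abs_mul, abs_mul]; norm_num
    nlinarith [neg_abs_le (2 * (κ + 1) * (t - t₀)), abs_nonneg (t - t₀)]

/-- Version of `exists_separating_slopes` at a point `x₀`, on its left (`σ = 1`) or on its right
(`σ = -1`). -/
lemma exists_separating_slopes_at {W₁ W₂ g₁ g₂ : ℝ → ℝ} (hW₁ : Continuous W₁)
    (hW₂ : Continuous W₂) {x₀ σ : ℝ} (hσ : σ = 1 ∨ σ = -1)
    (hneg : ∀ᶠ y in 𝓝[<] (0 : ℝ), x₀ + σ * y < 0)
    (hle : ∀ x ≤ 0, W₁ x + W₂ x ≤ W₁ x₀ + W₂ x₀)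
    (hg₁ : Continuous g₁) {c R : ℝ} (hc : 0 < c)
    (hgg : ∀ p, g₁ p < c → 0 < g₂ (-p)) (hR : ∀ p, R ≤ |p| → c ≤ g₁ p)
    (hN₁ : ∀ r, 0 < g₁ r → ∀ᶠ q in 𝓝 x₀ ×ˢ 𝓝 r, q.1 < 0 → ¬ TouchedAbove W₁ q.2 q.1)
    (hN₂ : ∀ r, 0 < g₂ r → ∀ᶠ q in 𝓝 x₀ ×ˢ 𝓝 r, q.1 < 0 → ¬ TouchedAbove W₂ q.2 q.1)
    (hst : ∀ᶠ x in 𝓝 x₀, x < 0 → ∀ m, R ≤ |m| → ¬ TouchedAbove W₁ m x) :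
    ∃ r r', r < r' ∧ ∀ s ∈ Icc r r', 0 < g₁ (σ * s) ∧ g₁ (σ * s) < c ∧
      (∀ᶠ y in 𝓝[<] (0 : ℝ), W₁ (x₀ + σ * y) ≤ W₁ x₀ + s * y) ∧
      (∀ᶠ y in 𝓝[<] (0 : ℝ), W₂ (x₀ + σ * y) ≤ W₂ x₀ - s * y) := by
  have hσ2 : σ ^ 2 = 1 := by rcases hσ with h | h <;> rw [h] <;> norm_num
  have hσa : ∀ p, |σ * p| = |p| := fun p => by rcases hσ with h | h <;> simp [h]
  have hlim : Tendsto (fun y : ℝ => x₀ + σ * y) (𝓝[<] 0) (𝓝 x₀) := by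
    have : Continuous fun y : ℝ => x₀ + σ * y := by fun_prop
    have h := this.tendsto 0
    simp only [mul_zero, add_zero] at h
    exact h.mono_left nhdsWithin_le_nhds
  have hN : ∀ (W g : ℝ → ℝ), (∀ r, 0 < g r → ∀ᶠ q in 𝓝 x₀ ×ˢ 𝓝 r,
      q.1 < 0 → ¬ TouchedAbove W q.2 q.1) → ∀ r, 0 < g (σ * r) →
      ∀ᶠ q in 𝓝[<] (0 : ℝ) ×ˢ 𝓝 r,
        ¬ TouchedAbove (fun y => W (x₀ + σ * y) - W x₀) q.2 q.1 := by
    intro W g hWg r hr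
    have hlim2 : Tendsto (fun q : ℝ × ℝ => (x₀ + σ * q.1, σ * q.2)) (𝓝[<] 0 ×ˢ 𝓝 r)
        (𝓝 x₀ ×ˢ 𝓝 (σ * r)) :=
      (hlim.comp tendsto_fst).prodMk (tendsto_snd.const_mul σ)
    filter_upwards [hlim2.eventually (hWg _ hr), tendsto_fst.eventually hneg] with q h1 h2 h3
    exact h1 h2 (h3.of_affine_comp hσ2)
  obtain ⟨r, r', hrr, hs⟩ := exists_separating_slopes
    (f₁ := fun y => W₁ (x₀ + σ * y) - W₁ x₀) (f₂ := fun y => W₂ (x₀ + σ * y) - W₂ x₀)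
    (g₁ := fun p => g₁ (σ * p)) (g₂ := fun p => g₂ (σ * p)) (R := R)
    (by fun_prop) (by fun_prop) (by simp) (by simp)
    (by filter_upwards [hneg] with y hy
        linarith [hle _ hy.le])
    (by fun_prop) hc (fun p hp => by rw [mul_neg]; exact hgg _ hp)
    (fun p hp => hR _ (by rwa [hσa])) (hN W₁ g₁ hN₁) (hN W₂ g₂ hN₂)
    (by filter_upwards [hlim.eventually hst, hneg] with y h1 h2 m hm h3
        exact h1 h2 _ (by rwa [hσa]) (h3.of_affine_comp hσ2))
  refine ⟨r, r', hrr, fun s hsI => ?_⟩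
  obtain ⟨h1, h2, h3, h4⟩ := hs s hsI
  refine ⟨h1, h2, h3.mono fun y hy => by linarith, h4.mono fun y hy => by linarith⟩

/-- Time slices of two subsolutions whose doubled sum has a parabolic-type maximum at
`(x₀, t₀, s₀)`. -/
lemma exists_pair_timeSlice {T : ℝ} {H₁ H₂ : ℝ → ℝ → ℝ → ℝ} {w₁ w₂ : ℝ → ℝ → ℝ}
    (hs₁ : ViscSubIn T H₁ w₁) (hs₂ : ViscSubIn T H₂ w₂)
    (hH₁ : ContinuousOn (fun q : ℝ × ℝ × ℝ => H₁ q.1 q.2.1 q.2.2)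
      {q : ℝ × ℝ × ℝ | q.2.1 ≤ 0 ∧ q.2.2 ∈ Icc 0 T})
    (hH₂ : ContinuousOn (fun q : ℝ × ℝ × ℝ => H₂ q.1 q.2.1 q.2.2)
      {q : ℝ × ℝ × ℝ | q.2.1 ≤ 0 ∧ q.2.2 ∈ Icc 0 T})
    (hw₁ : Continuous fun q : ℝ × ℝ => w₁ q.1 q.2) (hw₂ : Continuous fun q : ℝ × ℝ => w₂ q.1 q.2)
    {x₀ t₀ s₀ a κ c R : ℝ} (hx₀ : x₀ ≤ 0) (ht₀ : t₀ ∈ Ioc 0 T) (hs₀ : s₀ ∈ Ioc 0 T) (hc : 0 < c)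
    (hmax : ∀ x ≤ 0, ∀ t ∈ Icc 0 T, ∀ s ∈ Icc 0 T, w₁ x t + w₂ x s ≤ w₁ x₀ t₀ + w₂ x₀ s₀ +
      a * (t - t₀) - a * (s - s₀) + κ * (t - t₀) ^ 2 + κ * (s - s₀) ^ 2)
    (hgg : ∀ p, a + H₁ p x₀ t₀ < c → 0 < -a + H₂ (-p) x₀ s₀)
    (hR : ∀ p x t, x ≤ 0 → t ∈ Icc 0 T → R ≤ |p| → c + 1 - a ≤ H₁ p x t) :
    ∃ W₁ W₂ : ℝ → ℝ, W₁ x₀ = w₁ x₀ t₀ ∧ W₂ x₀ = w₂ x₀ s₀ ∧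
      (∀ x, ∀ t ∈ Icc 0 T, w₁ x t ≤ W₁ x + a * (t - t₀) + (κ + 1) * (t - t₀) ^ 2) ∧
      (∀ x, ∀ s ∈ Icc 0 T, w₂ x s ≤ W₂ x - a * (s - s₀) + (κ + 1) * (s - s₀) ^ 2) ∧
      (∀ r, 0 < a + H₁ r x₀ t₀ →
        ∀ᶠ q in 𝓝 x₀ ×ˢ 𝓝 r, q.1 < 0 → ¬ TouchedAbove W₁ q.2 q.1) ∧
      (∀ r, 0 < -a + H₂ r x₀ s₀ →
        ∀ᶠ q in 𝓝 x₀ ×ˢ 𝓝 r, q.1 < 0 → ¬ TouchedAbove W₂ q.2 q.1) ∧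
      ∀ σ : ℝ, σ = 1 ∨ σ = -1 → (∀ᶠ y in 𝓝[<] (0 : ℝ), x₀ + σ * y < 0) →
        ∃ r r', r < r' ∧ ∀ s ∈ Icc r r', 0 < a + H₁ (σ * s) x₀ t₀ ∧ a + H₁ (σ * s) x₀ t₀ < c ∧
          (∀ᶠ y in 𝓝[<] (0 : ℝ), W₁ (x₀ + σ * y) ≤ W₁ x₀ + s * y) ∧
          (∀ᶠ y in 𝓝[<] (0 : ℝ), W₂ (x₀ + σ * y) ≤ W₂ x₀ - s * y) := by
  have ht₀' := Ioc_subset_Icc_self ht₀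
  have hs₀' := Ioc_subset_Icc_self hs₀
  obtain ⟨W₁, hW₁, h10, h1le, h1att, h1N, h1st⟩ := hs₁.exists_timeSlice hH₁ hw₁ (κ := κ) (a := a)
    hx₀ ht₀ (fun t ht => by have := hmax x₀ hx₀ t ht s₀ hs₀'; nlinarith)
  obtain ⟨W₂, hW₂, h20, h2le, h2att, h2N, -⟩ := hs₂.exists_timeSlice hH₂ hw₂ (κ := κ) (a := -a)
    hx₀ hs₀ (fun s hs => by have := hmax x₀ hx₀ t₀ ht₀' s hs; nlinarith)
  refine ⟨W₁, W₂, h10, h20, h1le, fun x s hs => by linarith [h2le x s hs], h1N, h2N,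
    fun σ hσ hneg => ?_⟩
  refine exists_separating_slopes_at (g₁ := fun p => a + H₁ p x₀ t₀)
    (g₂ := fun p => -a + H₂ p x₀ s₀) (R := R) hW₁ hW₂ hσ hneg ?_ ?_ hc hgg
    (fun p hp => by linarith [hR p x₀ t₀ hx₀ ht₀' hp]) h1N h2N
    (h1st R fun p x t hx ht hp => by linarith [hR p x t hx ht hp])
  · intro x hx
    obtain ⟨t, ht, h1⟩ := h1att x
    obtain ⟨s, hs, h2⟩ := h2att x
    have := hmax x hx t ht s hs
    nlinarith [sq_nonneg (t - t₀), sq_nonneg (s - s₀)]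
  · exact continuous_const.add (hH₁.comp_continuous (f := fun p : ℝ => (p, x₀, t₀))
      (by fun_prop) fun p => ⟨hx₀, ht₀'⟩)

lemma interior_max_false {T : ℝ} {H₁ H₂ : ℝ → ℝ → ℝ → ℝ} {w₁ w₂ : ℝ → ℝ → ℝ}
    (hs₁ : ViscSubIn T H₁ w₁) (hs₂ : ViscSubIn T H₂ w₂)
    (hH₁ : ContinuousOn (fun q : ℝ × ℝ × ℝ => H₁ q.1 q.2.1 q.2.2)
      {q : ℝ × ℝ × ℝ | q.2.1 ≤ 0 ∧ q.2.2 ∈ Icc 0 T})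
    (hH₂ : ContinuousOn (fun q : ℝ × ℝ × ℝ => H₂ q.1 q.2.1 q.2.2)
      {q : ℝ × ℝ × ℝ | q.2.1 ≤ 0 ∧ q.2.2 ∈ Icc 0 T})
    (hw₁ : Continuous fun q : ℝ × ℝ => w₁ q.1 q.2) (hw₂ : Continuous fun q : ℝ × ℝ => w₂ q.1 q.2)
    {x₀ t₀ s₀ a κ c R : ℝ} (hx₀ : x₀ < 0) (ht₀ : t₀ ∈ Ioc 0 T) (hs₀ : s₀ ∈ Ioc 0 T) (hc : 0 < c)
    (hmax : ∀ x ≤ 0, ∀ t ∈ Icc 0 T, ∀ s ∈ Icc 0 T, w₁ x t + w₂ x s ≤ w₁ x₀ t₀ + w₂ x₀ s₀ +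
      a * (t - t₀) - a * (s - s₀) + κ * (t - t₀) ^ 2 + κ * (s - s₀) ^ 2)
    (hgg : ∀ p, a + H₁ p x₀ t₀ < c → 0 < -a + H₂ (-p) x₀ s₀)
    (hR : ∀ p x t, x ≤ 0 → t ∈ Icc 0 T → R ≤ |p| → c + 1 - a ≤ H₁ p x t) : False := by
  obtain ⟨W₁, W₂, -, -, -, -, h1N, h2N, hsep⟩ := exists_pair_timeSlice hs₁ hs₂ hH₁ hH₂ hw₁ hw₂
    hx₀.le ht₀ hs₀ hc hmax hgg hR
  have hneg : ∀ σ : ℝ, ∀ᶠ y in 𝓝[<] (0 : ℝ), x₀ + σ * y < 0 := fun σ => by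
    have : Continuous fun y : ℝ => x₀ + σ * y := by fun_prop
    exact (this.continuousAt.eventually (gt_mem_nhds (by simpa using hx₀))).filter_mono
      nhdsWithin_le_nhds
  obtain ⟨l, l', hll, hl⟩ := hsep 1 (Or.inl rfl) (hneg 1)
  obtain ⟨r, r', hrr, hr⟩ := hsep (-1) (Or.inr rfl) (hneg (-1))
  obtain ⟨hl1, hl2, hl3, hl4⟩ := hl l ⟨le_rfl, hll.le⟩
  obtain ⟨-, -, hr3, hr4⟩ := hr r ⟨le_rfl, hrr.le⟩
  rw [one_mul] at hl1 hl2
  have htouch : ∀ (W : ℝ → ℝ) (m n : ℝ), n ≤ m →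
      (∀ᶠ y in 𝓝[<] (0 : ℝ), W (x₀ + 1 * y) ≤ W x₀ + m * y) →
      (∀ᶠ y in 𝓝[<] (0 : ℝ), W (x₀ + -1 * y) ≤ W x₀ - n * y) → TouchedAbove W m x₀ := by
    intro W m n hnm h1 h2
    obtain ⟨k, hk, hk'⟩ := mem_nhdsLT_iff_exists_Ioo_subset.1 (h1.and h2)
    have hk0 : k < 0 := hk
    refine ⟨0, ?_⟩
    filter_upwards [Ioo_mem_nhds (show x₀ + k < x₀ by linarith) (show x₀ < x₀ - k by linarith)]
      with x hx
    rcases lt_trichotomy x x₀ with h | h | h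
    · have := (hk' (show x - x₀ ∈ Ioo k 0 from ⟨by linarith [hx.1], by linarith⟩)).1
      rw [show x₀ + 1 * (x - x₀) = x by ring] at this
      linarith
    · rw [h]
    · have := (hk' (show x₀ - x ∈ Ioo k 0 from ⟨by linarith [hx.2], by linarith⟩)).2
      rw [show x₀ + -1 * (x₀ - x) = x by ring] at this
      nlinarith
  have hself : ∀ {W : ℝ → ℝ} {m : ℝ},
      (∀ᶠ q in 𝓝 x₀ ×ˢ 𝓝 m, q.1 < 0 → ¬ TouchedAbove W q.2 q.1) → ¬ TouchedAbove W m x₀ :=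
    fun {W m} h => by
      rw [← nhds_prod_eq] at h
      exact h.self_of_nhds hx₀
  rcases le_total (-r) l with h | h
  · exact hself (h1N l hl1) (htouch W₁ l (-r) h hl3 (hr3.mono fun y hy => by linarith))
  · exact hself (h2N (-l) (hgg l hl2)) (htouch W₂ (-l) r (by linarith)
      (hl4.mono fun y hy => by linarith) hr4)

lemma junction_slopes {T : ℝ} {H₁ H₂ : ℝ → ℝ → ℝ → ℝ} {w₁ w₂ : ℝ → ℝ → ℝ}
    (hs₁ : ViscSubIn T H₁ w₁) (hs₂ : ViscSubIn T H₂ w₂)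
    (hH₁ : ContinuousOn (fun q : ℝ × ℝ × ℝ => H₁ q.1 q.2.1 q.2.2)
      {q : ℝ × ℝ × ℝ | q.2.1 ≤ 0 ∧ q.2.2 ∈ Icc 0 T})
    (hH₂ : ContinuousOn (fun q : ℝ × ℝ × ℝ => H₂ q.1 q.2.1 q.2.2)
      {q : ℝ × ℝ × ℝ | q.2.1 ≤ 0 ∧ q.2.2 ∈ Icc 0 T})
    (hw₁ : Continuous fun q : ℝ × ℝ => w₁ q.1 q.2) (hw₂ : Continuous fun q : ℝ × ℝ => w₂ q.1 q.2)
    {t₀ s₀ a κ c R : ℝ} (ht₀ : t₀ ∈ Ioc 0 T) (hs₀ : s₀ ∈ Ioc 0 T) (hc : 0 < c)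
    (hmax : ∀ x ≤ 0, ∀ t ∈ Icc 0 T, ∀ s ∈ Icc 0 T, w₁ x t + w₂ x s ≤ w₁ 0 t₀ + w₂ 0 s₀ +
      a * (t - t₀) - a * (s - s₀) + κ * (t - t₀) ^ 2 + κ * (s - s₀) ^ 2)
    (hgg : ∀ p, a + H₁ p 0 t₀ < c → 0 < -a + H₂ (-p) 0 s₀)
    (hR : ∀ p x t, x ≤ 0 → t ∈ Icc 0 T → R ≤ |p| → c + 1 - a ≤ H₁ p x t) :
    ∃ r r', r < r' ∧ 0 < -a + H₂ (-r) 0 s₀ ∧ 0 < a + H₁ r' 0 t₀ ∧ ∃ δ > 0, ∀ x ∈ Ioc (-δ) 0,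
      (∀ t ∈ Icc 0 T,
        w₁ x t ≤ w₁ 0 t₀ + r' * x + a * (t - t₀) + (κ + 1) * (t - t₀) ^ 2) ∧
      ∀ s ∈ Icc 0 T,
        w₂ x s ≤ w₂ 0 s₀ - r * x - a * (s - s₀) + (κ + 1) * (s - s₀) ^ 2 := by
  obtain ⟨W₁, W₂, h10, h20, h1le, h2le, -, -, hsep⟩ := exists_pair_timeSlice hs₁ hs₂ hH₁ hH₂
    hw₁ hw₂ le_rfl ht₀ hs₀ hc hmax hgg hR
  obtain ⟨r, r', hrr, h⟩ := hsep 1 (Or.inl rfl) (by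
    filter_upwards [self_mem_nhdsWithin] with y (hy : y < 0)
    linarith)
  obtain ⟨-, hr2, -, hr4⟩ := h r ⟨le_rfl, hrr.le⟩
  obtain ⟨hr1', -, hr3', -⟩ := h r' ⟨hrr.le, le_rfl⟩
  rw [one_mul] at hr2 hr1'
  refine ⟨r, r', hrr, hgg r hr2, hr1', ?_⟩
  obtain ⟨k, hk, hk'⟩ := mem_nhdsLT_iff_exists_Ioo_subset.1 (hr3'.and hr4)
  have hk0 : k < 0 := hk
  refine ⟨-k, by linarith, fun x hx => ?_⟩
  have hW : W₁ x ≤ w₁ 0 t₀ + r' * x ∧ W₂ x ≤ w₂ 0 s₀ - r * x := by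
    rcases eq_or_lt_of_le hx.2 with h0 | h0
    · rw [h0, h10, h20]; simp
    · have := hk' (show x ∈ Ioo k 0 from ⟨by linarith [hx.1], h0⟩)
      simpa only [zero_add, one_mul, h10, h20, mem_ofPred_eq] using this
  exact ⟨fun t ht => by linarith [h1le x t ht, hW.1], fun s hs => by linarith [h2le x s hs, hW.2]⟩

lemma ViscSubIn.sub_mul_time {T : ℝ} {H : ℝ → ℝ → ℝ → ℝ} {w : ℝ → ℝ → ℝ} (hw : ViscSubIn T H w)
    (η : ℝ) : ViscSubIn T (fun p x t => H p x t + η) fun x t => w x t - η * t := by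
  intro φ x₀ t₀ hx₀ ht₀ htT hφ hmax
  have hd := (hφ.differentiable one_ne_zero).differentiableAt (x := (x₀, t₀))
  have hψ := hd.hasFDerivAt.add
    ((hasFDerivAt_snd (𝕜 := ℝ) (E := ℝ) (F := ℝ) (p := (x₀, t₀))).const_mul η)
  have h := hw (fun q => φ q + η * q.2) x₀ t₀ hx₀ ht₀ htT (by fun_prop)
    (by filter_upwards [hmax] with q hq; linarith)
  have e : fderiv ℝ (fun q : ℝ × ℝ => φ q + η * q.2) (x₀, t₀) = _ := hψ.fderiv
  rw [e] at h
  simp at h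
  linarith

lemma ViscSuperIn.neg_sub_mul_sq {T : ℝ} {H : ℝ → ℝ → ℝ → ℝ} {w : ℝ → ℝ → ℝ}
    (hw : ViscSuperIn T H w) (ε : ℝ) :
    ViscSubIn T (fun p x t => -H (-p - 2 * ε * x) x t) fun x t => -w x t - ε * x ^ 2 := by
  intro φ x₀ t₀ hx₀ ht₀ htT hφ hmax
  have hd := (hφ.differentiable one_ne_zero).differentiableAt (x := (x₀, t₀))
  have hψ := hd.hasFDerivAt.neg.sub
    (((hasFDerivAt_fst (𝕜 := ℝ) (E := ℝ) (F := ℝ) (p := (x₀, t₀))).pow 2).const_mul ε)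
  have h := hw (fun q => -φ q - ε * q.1 ^ 2) x₀ t₀ hx₀ ht₀ htT (by fun_prop)
    (by filter_upwards [hmax] with q hq; linarith)
  have e : fderiv ℝ (fun q : ℝ × ℝ => -φ q - ε * q.1 ^ 2) (x₀, t₀) = _ := hψ.fderiv
  rw [e] at h
  simp at h
  rw [show ε * (2 * x₀) = 2 * ε * x₀ by ring] at h
  linarith

lemma ViscSubIn.congr {T : ℝ} {H : ℝ → ℝ → ℝ → ℝ} {w w' : ℝ → ℝ → ℝ} (hw : ViscSubIn T H w)
    (h : ∀ x ≤ 0, ∀ t ∈ Icc 0 T, w' x t = w x t) : ViscSubIn T H w' := by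
  intro φ x₀ t₀ hx₀ ht₀ htT hφ hmax
  refine hw φ x₀ t₀ hx₀ ht₀ htT hφ ?_
  filter_upwards [hmax, self_mem_nhdsWithin] with q hq hqD
  rwa [h _ hqD.1 _ hqD.2, h _ hx₀.le _ ⟨ht₀.le, htT⟩] at hq

lemma ViscSuperIn.congr {T : ℝ} {H : ℝ → ℝ → ℝ → ℝ} {w w' : ℝ → ℝ → ℝ} (hw : ViscSuperIn T H w)
    (h : ∀ x ≤ 0, ∀ t ∈ Icc 0 T, w' x t = w x t) : ViscSuperIn T H w' := by
  intro φ x₀ t₀ hx₀ ht₀ htT hφ hmax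
  refine hw φ x₀ t₀ hx₀ ht₀ htT hφ ?_
  filter_upwards [hmax, self_mem_nhdsWithin] with q hq hqD
  rwa [h _ hqD.1 _ hqD.2, h _ hx₀.le _ ⟨ht₀.le, htT⟩] at hq

lemma KirchhoffSubsolution.congr {K : ℕ} {hK : 0 < K} {T B : ℝ} {H : Fin K → ℝ → ℝ → ℝ → ℝ}
    {u u' : Fin K → ℝ → ℝ → ℝ} (hu : KirchhoffSubsolution hK T B H u)
    (h : ∀ i, ∀ x ≤ 0, ∀ t ∈ Icc 0 T, u' i x t = u i x t) :
    KirchhoffSubsolution hK T B H u' := by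
  refine ⟨fun i => (hu.1 i).congr (h i), fun t₀ ht₀ p a hp => hu.2 t₀ ht₀ p a fun i ε hε => ?_⟩
  obtain ⟨δ, hδ, hp⟩ := hp i ε hε
  refine ⟨δ, hδ, fun x t hx ht hxt => ?_⟩
  have := hp x t hx ht hxt
  rwa [h i x hx t ht, h i 0 le_rfl t₀ (Ioc_subset_Icc_self ht₀)] at this

lemma KirchhoffSupersolution.congr {K : ℕ} {hK : 0 < K} {T B : ℝ} {H : Fin K → ℝ → ℝ → ℝ → ℝ}
    {u u' : Fin K → ℝ → ℝ → ℝ} (hu : KirchhoffSupersolution hK T B H u)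
    (h : ∀ i, ∀ x ≤ 0, ∀ t ∈ Icc 0 T, u' i x t = u i x t) :
    KirchhoffSupersolution hK T B H u' := by
  refine ⟨fun i => (hu.1 i).congr (h i), fun t₀ ht₀ p a hp => hu.2 t₀ ht₀ p a fun i ε hε => ?_⟩
  obtain ⟨δ, hδ, hp⟩ := hp i ε hε
  refine ⟨δ, hδ, fun x t hx ht hxt => ?_⟩
  have := hp x t hx ht hxt
  rwa [h i x hx t ht, h i 0 le_rfl t₀ (Ioc_subset_Icc_self ht₀)] at this

/-- A function on `JDom T`, extended constantly outside of it. -/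
def clampExtend (T : ℝ) (f : ℝ → ℝ → ℝ) (x t : ℝ) : ℝ := f (min x 0) (max 0 (min t T))

lemma clampExtend_eq {T : ℝ} (f : ℝ → ℝ → ℝ) {x t : ℝ} (hx : x ≤ 0) (ht : t ∈ Icc 0 T) :
    clampExtend T f x t = f x t := by
  simp [clampExtend, hx, ht.1, ht.2]

lemma continuous_clampExtend {T : ℝ} (hT : 0 < T) {f : ℝ → ℝ → ℝ}
    (hf : ∀ ε > (0 : ℝ), ∃ δ > (0 : ℝ), ∀ x₁ t₁ x₂ t₂ : ℝ,
      x₁ ≤ 0 → x₂ ≤ 0 → t₁ ∈ Icc 0 T → t₂ ∈ Icc 0 T →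
      |x₁ - x₂| + |t₁ - t₂| < δ → |f x₁ t₁ - f x₂ t₂| ≤ ε) :
    Continuous fun q : ℝ × ℝ => clampExtend T f q.1 q.2 := by
  have hc : ContinuousOn (fun q : ℝ × ℝ => f q.1 q.2) (JDom T) := by
    rw [Metric.continuousOn_iff]
    intro b hb ε hε
    obtain ⟨δ, hδ, h⟩ := hf (ε / 2) (half_pos hε)
    refine ⟨δ / 2, half_pos hδ, fun q hq hd => ?_⟩
    rw [Prod.dist_eq, max_lt_iff, Real.dist_eq, Real.dist_eq] at hd
    rw [Real.dist_eq]
    have := h q.1 q.2 b.1 b.2 hq.1 hb.1 hq.2 hb.2 (by linarith [hd.1, hd.2])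
    linarith
  refine hc.comp_continuous (f := fun q : ℝ × ℝ => (min q.1 0, max 0 (min q.2 T))) (by fun_prop)
    fun q => ⟨min_le_right _ _, le_max_left _ _, max_le hT.le (min_le_right _ _)⟩

lemma exists_forall_le_of_compact {ι X : Type*} [Finite ι] [TopologicalSpace X] {F : ι → X → ℝ}
    (hF : ∀ i, Continuous (F i)) {S D : Set X} (hS : IsCompact S) {j : ι} {q : X} (hq : q ∈ S)
    (hout : ∀ i, ∀ y ∈ D, y ∉ S → F i y ≤ F j q) :
    ∃ i₀, ∃ q₀ ∈ S, F j q ≤ F i₀ q₀ ∧ ∀ i, ∀ y ∈ D, F i y ≤ F i₀ q₀ := by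
  have : Nonempty ι := ⟨j⟩
  choose m hmS hm using fun i => hS.exists_isMaxOn ⟨q, hq⟩ (hF i).continuousOn
  obtain ⟨i₀, hi₀⟩ := Finite.exists_max fun i => F i (m i)
  have hj : F j q ≤ F i₀ (m i₀) := le_trans (hm j hq) (hi₀ j)
  refine ⟨i₀, m i₀, hmS i₀, hj, fun i y hy => ?_⟩
  by_cases h : y ∈ S
  · exact le_trans (hm i h) (hi₀ i)
  · exact (hout i y hy h).trans hj

/-- The penalized difference of a sub- and a supersolution, with time doubled, has no maximum at
positive times. -/
lemma penalized_max_false {K : ℕ} {hK : 0 < K} {T B : ℝ} {H : Fin K → ℝ → ℝ → ℝ → ℝ}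
    (hHcont : ∀ i, ContinuousOn (fun q : ℝ × ℝ × ℝ => H i q.1 q.2.1 q.2.2)
      {q : ℝ × ℝ × ℝ | q.2.1 ≤ 0 ∧ q.2.2 ∈ Icc 0 T})
    {u v : Fin K → ℝ → ℝ → ℝ} (huc : ∀ i, Continuous fun q : ℝ × ℝ => u i q.1 q.2)
    (hvc : ∀ i, Continuous fun q : ℝ × ℝ => v i q.1 q.2)
    (hujct : ∀ i j : Fin K, ∀ t ∈ Icc (0 : ℝ) T, u i 0 t = u j 0 t)
    (hvjct : ∀ i j : Fin K, ∀ t ∈ Icc (0 : ℝ) T, v i 0 t = v j 0 t)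
    (hu : KirchhoffSubsolution hK T B H u) (hv : KirchhoffSupersolution hK T B H v)
    {ε η θ c R x₀ t₀ s₀ : ℝ} {i₀ : Fin K} (hε : 0 ≤ ε) (hθ : 0 < θ) (hη : 0 < η) (hc : 0 < c)
    (hx₀ : x₀ ≤ 0)
    (ht₀ : t₀ ∈ Ioc 0 T) (hs₀ : s₀ ∈ Ioc 0 T)
    (hmax : ∀ i, ∀ x ≤ 0, ∀ t ∈ Icc 0 T, ∀ s ∈ Icc 0 T,
      u i x t - η * t - v i x s - (t - s) ^ 2 / (2 * θ) - ε * x ^ 2 ≤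
      u i₀ x₀ t₀ - η * t₀ - v i₀ x₀ s₀ - (t₀ - s₀) ^ 2 / (2 * θ) - ε * x₀ ^ 2)
    (hgg : ∀ i p, (t₀ - s₀) / θ + (H i p x₀ t₀ + η) < c →
      (t₀ - s₀) / θ + H i (p - 2 * ε * x₀) x₀ s₀ < 0)
    (hR : ∀ i p x t, x ≤ 0 → t ∈ Icc 0 T → R ≤ |p| → c + 1 - (t₀ - s₀) / θ ≤ H i p x t) :
    False := by
  set a := (t₀ - s₀) / θ with ha
  have hs₁ := fun i => (hu.1 i).sub_mul_time η
  have hs₂ := fun i => (hv.1 i).neg_sub_mul_sq ε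
  have hH₁ : ∀ i, ContinuousOn (fun q : ℝ × ℝ × ℝ => H i q.1 q.2.1 q.2.2 + η)
      {q : ℝ × ℝ × ℝ | q.2.1 ≤ 0 ∧ q.2.2 ∈ Icc 0 T} := fun i => (hHcont i).add continuousOn_const
  have hH₂ : ∀ i, ContinuousOn
      (fun q : ℝ × ℝ × ℝ => -H i (-q.1 - 2 * ε * q.2.1) q.2.1 q.2.2)
      {q : ℝ × ℝ × ℝ | q.2.1 ≤ 0 ∧ q.2.2 ∈ Icc 0 T} := fun i =>
    ((hHcont i).comp (f := fun q : ℝ × ℝ × ℝ => (-q.1 - 2 * ε * q.2.1, q.2.1, q.2.2))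
      (by fun_prop) fun q hq => hq).neg
  have hw₁ : ∀ i, Continuous fun q : ℝ × ℝ => u i q.1 q.2 - η * q.2 := fun i =>
    (huc i).sub (by fun_prop)
  have hw₂ : ∀ i, Continuous fun q : ℝ × ℝ => -v i q.1 q.2 - ε * q.1 ^ 2 := fun i =>
    (hvc i).neg.sub (by fun_prop)
  have hquad : ∀ t s : ℝ, (t - s) ^ 2 / (2 * θ) - (t₀ - s₀) ^ 2 / (2 * θ) ≤
      a * (t - t₀) - a * (s - s₀) + 1 / θ * (t - t₀) ^ 2 + 1 / θ * (s - s₀) ^ 2 := by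
    intro t s
    have e : a * (t - t₀) - a * (s - s₀) + 1 / θ * (t - t₀) ^ 2 + 1 / θ * (s - s₀) ^ 2 -
        ((t - s) ^ 2 / (2 * θ) - (t₀ - s₀) ^ 2 / (2 * θ)) =
        (t - t₀ + (s - s₀)) ^ 2 / (2 * θ) := by
      rw [ha]; field_simp; ring
    have : 0 ≤ (t - t₀ + (s - s₀)) ^ 2 / (2 * θ) := by positivity
    linarith
  have hmax' : ∀ i, ∀ x ≤ 0, ∀ t ∈ Icc 0 T, ∀ s ∈ Icc 0 T,
      (u i x t - η * t) + (-v i x s - ε * x ^ 2) ≤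
      (u i₀ x₀ t₀ - η * t₀) + (-v i₀ x₀ s₀ - ε * x₀ ^ 2) + a * (t - t₀) - a * (s - s₀) +
        1 / θ * (t - t₀) ^ 2 + 1 / θ * (s - s₀) ^ 2 := fun i x hx t ht s hs => by
    linarith [hmax i x hx t ht s hs, hquad t s]
  have hgg' : ∀ i p, a + (H i p x₀ t₀ + η) < c →
      0 < -a + -H i (-(-p) - 2 * ε * x₀) x₀ s₀ := fun i p hp => by
    have := hgg i p hp
    rw [neg_neg]
    linarith
  have hR' : ∀ i p x t, x ≤ 0 → t ∈ Icc 0 T → R ≤ |p| → c + 1 - a ≤ H i p x t + η :=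
    fun i p x t hx ht hp => by linarith [hR i p x t hx ht hp]
  rcases hx₀.lt_or_eq with hx₀ | rfl
  · exact interior_max_false (hs₁ i₀) (hs₂ i₀) (hH₁ i₀) (hH₂ i₀) (hw₁ i₀) (hw₂ i₀) hx₀ ht₀ hs₀ hc
      (hmax' i₀) (hgg' i₀) (hR' i₀)
  have ht₀' := Ioc_subset_Icc_self ht₀
  have hs₀' := Ioc_subset_Icc_self hs₀
  have hslopes := fun i => junction_slopes (hs₁ i) (hs₂ i) (hH₁ i) (hH₂ i) (hw₁ i) (hw₂ i) ht₀ hs₀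
    hc (fun x hx t ht s hs => by
      have := hmax' i x hx t ht s hs
      rwa [hujct i₀ i t₀ ht₀', hvjct i₀ i s₀ hs₀'] at this) (hgg' i) (hR' i)
  choose r r' hrr hr hr' δ hδ hsl using hslopes
  have hsmall : ∀ b > 0, ∀ y : ℝ, |y| < b / (1 / θ + 1) → (1 / θ + 1) * y ^ 2 ≤ b * |y| := by
    intro b hb y hy
    rw [lt_div_iff₀ (by positivity)] at hy
    rw [← sq_abs]
    nlinarith [abs_nonneg y]
  have hsup : JunctionSuperjet K T u t₀ r' (a + η) := by
    intro i b hb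
    refine ⟨min (δ i) (b / (1 / θ + 1)), lt_min (hδ i) (by positivity), fun x t hx ht hxt => ?_⟩
    have h1 := hxt.trans_le (min_le_left _ _)
    have h2 := hxt.trans_le (min_le_right _ _)
    have h3 := (hsl i x ⟨by linarith [neg_abs_le x, abs_nonneg (t - t₀)], hx⟩).1 t ht
    have h4 := hsmall b hb (t - t₀) (by linarith [abs_nonneg x])
    linarith [mul_nonneg hb.le (abs_nonneg x)]
  have hsub : JunctionSubjet K T v s₀ r a := by
    intro i b hb
    refine ⟨min (min (δ i) (b / (1 / θ + 1))) (b / (ε + 1)),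
      lt_min (lt_min (hδ i) (by positivity)) (by positivity), fun x t hx ht hxt => ?_⟩
    have h0 := hxt.trans_le (min_le_left _ _)
    have h1 := h0.trans_le (min_le_left _ _)
    have h2 := h0.trans_le (min_le_right _ _)
    have h5 := hxt.trans_le (min_le_right _ _)
    have h3 := (hsl i x ⟨by linarith [neg_abs_le x, abs_nonneg (t - s₀)], hx⟩).2 t ht
    have h4 := hsmall b hb (t - s₀) (by linarith [abs_nonneg x])
    rw [lt_div_iff₀ (by positivity)] at h5
    have h6 : ε * x ^ 2 ≤ b * |x| := by
      rw [← sq_abs]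
      nlinarith [abs_nonneg x, abs_nonneg (t - s₀), mul_nonneg hε (abs_nonneg (t - s₀)),
        mul_nonneg hε (abs_nonneg x)]
    linarith
  have h1 := hu.2 t₀ ht₀ r' (a + η) hsup
  have h2 := hv.2 s₀ hs₀ r a hsub
  have h3 : 0 < jmin hK fun i => a + η + H i (r' i) 0 t₀ :=
    (Finset.lt_inf'_iff _).2 fun i _ => by linarith [hr' i]
  have h4 : (jmax hK fun i => a + H i (r i) 0 s₀) < 0 :=
    (Finset.sup'_lt_iff _).2 fun i _ => by
      have := hr i
      rw [neg_neg, mul_zero, sub_zero] at this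
      linarith
  have h5 : ∑ i, r' i - B ≤ 0 := (min_le_iff.1 h1).resolve_right h3.not_ge
  have h6 : 0 ≤ ∑ i, r i - B := (le_max_iff.1 h2).resolve_right h4.not_ge
  have h7 : ∑ i, r i < ∑ i, r' i :=
    Finset.sum_lt_sum_of_nonempty ⟨⟨0, hK⟩, Finset.mem_univ _⟩ fun i _ => hrr i
  linarith

/-- The comparison principle for `u` and `v` continuous on all of `ℝ × ℝ`, by doubling the time
variable only. -/
lemma kirchhoff_comparison_of_continuous {K : ℕ} {hK : 0 < K} {T B : ℝ}
    {H : Fin K → ℝ → ℝ → ℝ → ℝ}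
    (hHcont : ∀ i, ContinuousOn (fun q : ℝ × ℝ × ℝ => H i q.1 q.2.1 q.2.2)
      {q : ℝ × ℝ × ℝ | q.2.1 ≤ 0 ∧ q.2.2 ∈ Icc 0 T})
    (hHcoer : ∀ i, ∀ M : ℝ, ∃ R : ℝ, ∀ p x t : ℝ, x ≤ 0 → t ∈ Icc 0 T →
      R ≤ |p| → M ≤ H i p x t)
    (hHuc : ∀ i, ∀ R > (0 : ℝ), ∀ ε > (0 : ℝ), ∃ δ > (0 : ℝ),
      ∀ p₁ x₁ t₁ p₂ x₂ t₂ : ℝ, |p₁| ≤ R → |p₂| ≤ R → x₁ ≤ 0 → x₂ ≤ 0 →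
        t₁ ∈ Icc 0 T → t₂ ∈ Icc 0 T →
        |p₁ - p₂| + |x₁ - x₂| + |t₁ - t₂| < δ →
        |H i p₁ x₁ t₁ - H i p₂ x₂ t₂| ≤ ε)
    (hHlip : ∀ i, ∃ Λ : ℝ, ∀ p x t₁ t₂ : ℝ, x ≤ 0 →
      t₁ ∈ Icc 0 T → t₂ ∈ Icc 0 T →
      |H i p x t₁ - H i p x t₂| ≤ Λ * |t₁ - t₂|)
    {u v : Fin K → ℝ → ℝ → ℝ} (huc : ∀ i, Continuous fun q : ℝ × ℝ => u i q.1 q.2)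
    (hvc : ∀ i, Continuous fun q : ℝ × ℝ => v i q.1 q.2) {M : ℝ}
    (hubd : ∀ i x t, x ≤ 0 → t ∈ Icc 0 T → |u i x t| ≤ M)
    (hvbd : ∀ i x t, x ≤ 0 → t ∈ Icc 0 T → |v i x t| ≤ M)
    (huuc : ∀ ε > (0 : ℝ), ∃ δ > (0 : ℝ), ∀ i : Fin K, ∀ x₁ t₁ x₂ t₂ : ℝ,
      x₁ ≤ 0 → x₂ ≤ 0 → t₁ ∈ Icc 0 T → t₂ ∈ Icc 0 T →
      |x₁ - x₂| + |t₁ - t₂| < δ → |u i x₁ t₁ - u i x₂ t₂| ≤ ε)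
    (hvuc : ∀ ε > (0 : ℝ), ∃ δ > (0 : ℝ), ∀ i : Fin K, ∀ x₁ t₁ x₂ t₂ : ℝ,
      x₁ ≤ 0 → x₂ ≤ 0 → t₁ ∈ Icc 0 T → t₂ ∈ Icc 0 T →
      |x₁ - x₂| + |t₁ - t₂| < δ → |v i x₁ t₁ - v i x₂ t₂| ≤ ε)
    (hujct : ∀ i j : Fin K, ∀ t ∈ Icc (0 : ℝ) T, u i 0 t = u j 0 t)
    (hvjct : ∀ i j : Fin K, ∀ t ∈ Icc (0 : ℝ) T, v i 0 t = v j 0 t)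
    (hu : KirchhoffSubsolution hK T B H u) (hv : KirchhoffSupersolution hK T B H v)
    (hinit : ∀ i : Fin K, ∀ x ≤ (0 : ℝ), u i x 0 ≤ v i x 0)
    (j : Fin K) (x' t' : ℝ) (hx' : x' ≤ 0) (ht' : t' ∈ Icc 0 T) : u j x' t' ≤ v j x' t' := by
  by_contra! hcon
  have hT : 0 ≤ T := ht'.1.trans ht'.2
  obtain ⟨σ, hσ⟩ : ∃ σ, σ = u j x' t' - v j x' t' := ⟨_, rfl⟩
  have hσ0 : 0 < σ := by linarith
  have hM : 0 ≤ M := (abs_nonneg _).trans (hubd j x' t' hx' ht')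
  obtain ⟨η, hη, hηT⟩ : ∃ η > 0, ∀ t ∈ Icc 0 T, η * t ≤ σ / 4 := by
    refine ⟨σ / 4 / (T + 1), by positivity, fun t ht => ?_⟩
    rw [div_mul_eq_mul_div, div_le_iff₀ (by positivity)]
    nlinarith [ht.2]
  choose Λ hΛ using hHlip
  obtain ⟨δu, hδu, hδu'⟩ := huuc (σ / 4) (by positivity)
  obtain ⟨δv, hδv, hδv'⟩ := hvuc (σ / 4) (by positivity)
  obtain ⟨ρ, hρ, hρu, hρv, hρΛ⟩ : ∃ ρ > 0, ρ < δu ∧ ρ < δv ∧ ∀ i, Λ i * ρ < η / 4 := by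
    have hev : ∀ i, ∀ᶠ ρ in 𝓝[>] (0 : ℝ), Λ i * ρ < η / 4 := fun i =>
      (((continuous_const_mul (Λ i)).tendsto' 0 0 (mul_zero _)).mono_left
        nhdsWithin_le_nhds).eventually (gt_mem_nhds (by positivity))
    obtain ⟨ρ, ⟨h1, h2⟩, h3⟩ := ((eventually_mem_nhdsWithin (a := (0 : ℝ)) (s := Ioi 0)).and
      (eventually_mem_set.2 (Ioo_mem_nhdsGT (lt_min hδu hδv)))).and (eventually_all.2 hev) |>.exists
    exact ⟨ρ, h1, h2.2.trans_le (min_le_left _ _), h2.2.trans_le (min_le_right _ _), h3⟩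
  obtain ⟨θ, hθ, hθM⟩ : ∃ θ > 0, 4 * M * θ < ρ ^ 2 := by
    refine ⟨ρ ^ 2 / (4 * M + 1), by positivity, ?_⟩
    rw [mul_div_assoc', div_lt_iff₀ (by positivity)]
    nlinarith [sq_pos_of_pos hρ]
  obtain ⟨R, hR0, hR⟩ : ∃ R > 0, ∀ i p x t, x ≤ 0 → t ∈ Icc 0 T → R ≤ |p| →
      η / 4 + 1 + T / θ ≤ H i p x t := by
    have hev : ∀ i, ∀ᶠ R in atTop, ∀ p x t, x ≤ 0 → t ∈ Icc 0 T → R ≤ |p| →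
        η / 4 + 1 + T / θ ≤ H i p x t := fun i => by
      obtain ⟨R, hR⟩ := hHcoer i (η / 4 + 1 + T / θ)
      filter_upwards [eventually_ge_atTop R] with R' hR' p x t hx ht hp
      exact hR p x t hx ht (hR'.trans hp)
    exact ((eventually_gt_atTop 0).and (eventually_all.2 hev)).exists
  obtain ⟨δ, hδ, hδ1, hδH⟩ : ∃ δ > 0, δ < 1 ∧ ∀ i p q x t, |p| ≤ R + 1 → |q| ≤ R + 1 → x ≤ 0 →
      t ∈ Icc 0 T → |p - q| < δ → |H i p x t - H i q x t| ≤ η / 4 := by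
    have hev : ∀ i, ∀ᶠ δ in 𝓝[>] (0 : ℝ), ∀ p q x t, |p| ≤ R + 1 → |q| ≤ R + 1 → x ≤ 0 →
        t ∈ Icc 0 T → |p - q| < δ → |H i p x t - H i q x t| ≤ η / 4 := fun i => by
      obtain ⟨δ, hδ, h⟩ := hHuc i (R + 1) (by positivity) (η / 4) (by positivity)
      filter_upwards [Ioo_mem_nhdsGT hδ] with δ' hδ' p q x t hp hq hx ht hpq
      exact h p x t q x t hp hq hx hx ht ht (by simpa using hpq.trans hδ'.2)
    obtain ⟨δ, h1, h2⟩ := (((eventually_mem_set.2 (Ioo_mem_nhdsGT one_pos))).and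
      (eventually_all.2 hev)).exists
    exact ⟨δ, h1.1, h1.2, h2⟩
  obtain ⟨ε, hε, hεx, hεδ⟩ : ∃ ε > 0, ε * x' ^ 2 < σ / 4 ∧ 8 * M * ε < δ ^ 2 := by
    have h1 : ∀ᶠ ε in 𝓝[>] (0 : ℝ), ε * x' ^ 2 < σ / 4 :=
      (((continuous_mul_const (x' ^ 2)).tendsto' 0 0 (zero_mul _)).mono_left
        nhdsWithin_le_nhds).eventually (gt_mem_nhds (by positivity))
    have h2 : ∀ᶠ ε in 𝓝[>] (0 : ℝ), 8 * M * ε < δ ^ 2 :=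
      (((continuous_const_mul (8 * M)).tendsto' 0 0 (mul_zero _)).mono_left
        nhdsWithin_le_nhds).eventually (gt_mem_nhds (by positivity))
    exact (eventually_mem_nhdsWithin.and (h1.and h2)).exists
  obtain ⟨N, hNx, hN⟩ : ∃ N, |x'| ≤ N ∧ ∀ x, x ≤ -N → 2 * M ≤ ε * x ^ 2 := by
    refine ⟨|x'| + 2 * M / ε + 1, ?_, fun x hx => ?_⟩
    · have : 0 ≤ 2 * M / ε := by positivity
      linarith
    · have h1 : 0 ≤ 2 * M / ε := by positivity
      have h2 : 2 * M / ε ≤ x ^ 2 := by nlinarith [abs_nonneg x']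
      rw [div_le_iff₀ hε] at h2
      linarith
  obtain ⟨F, hF⟩ : ∃ F : Fin K → ℝ × ℝ × ℝ → ℝ, F = fun i q =>
      u i q.1 q.2.1 - η * q.2.1 - v i q.1 q.2.2 - (q.2.1 - q.2.2) ^ 2 / (2 * θ) - ε * q.1 ^ 2 :=
    ⟨_, rfl⟩
  have hFc : ∀ i, Continuous (F i) := fun i => by
    have h1 : Continuous fun q : ℝ × ℝ × ℝ => u i q.1 q.2.1 :=
      (huc i).comp (f := fun q : ℝ × ℝ × ℝ => (q.1, q.2.1)) (by fun_prop)
    have h2 : Continuous fun q : ℝ × ℝ × ℝ => v i q.1 q.2.2 :=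
      (hvc i).comp (f := fun q : ℝ × ℝ × ℝ => (q.1, q.2.2)) (by fun_prop)
    rw [hF]
    fun_prop
  have hFj : σ / 2 ≤ F j (x', t', t') := by
    rw [hF]
    simp only [sub_self]
    have := hηT t' ht'
    norm_num
    linarith
  have hFle : ∀ i x t s, x ≤ 0 → t ∈ Icc 0 T → s ∈ Icc 0 T →
      F i (x, t, s) ≤ 2 * M - (t - s) ^ 2 / (2 * θ) - ε * x ^ 2 := fun i x t s hx ht hs => by
    rw [hF]
    have h1 := (abs_le.1 (hubd i x t hx ht)).2
    have h2 := (abs_le.1 (hvbd i x s hx hs)).1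
    have h3 : 0 ≤ η * t := mul_nonneg hη.le ht.1
    simp only
    linarith
  obtain ⟨i₀, ⟨x₀, t₀, s₀⟩, ⟨hx₀', ht₀, hs₀⟩, hmax0, hmax⟩ := exists_forall_le_of_compact
    (D := {q : ℝ × ℝ × ℝ | q.1 ≤ 0 ∧ q.2.1 ∈ Icc 0 T ∧ q.2.2 ∈ Icc 0 T}) hFc
    ((isCompact_Icc (a := -N) (b := 0)).prod
      ((isCompact_Icc (a := 0) (b := T)).prod (isCompact_Icc (a := 0) (b := T))))
    (j := j) (q := (x', t', t')) ⟨⟨by linarith [neg_abs_le x'], hx'⟩, ht', ht'⟩ (by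
      rintro i ⟨x, t, s⟩ ⟨hx, ht, hs⟩ hS
      have hxN : x ≤ -N := by
        by_contra! h
        exact hS ⟨⟨h.le, hx⟩, ht, hs⟩
      have h1 := hFle i x t s hx ht hs
      have h2 : 0 ≤ (t - s) ^ 2 / (2 * θ) := by positivity
      linarith [hN x hxN])
  have hx₀ : x₀ ≤ 0 := hx₀'.2
  simp only at ht₀ hs₀
  have hpen := hFle i₀ x₀ t₀ s₀ hx₀ ht₀ hs₀
  have hp1 : 0 ≤ (t₀ - s₀) ^ 2 / (2 * θ) := by positivity
  have hp2 : 0 ≤ ε * x₀ ^ 2 := by positivity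
  have hts : |t₀ - s₀| < ρ := by
    refine abs_lt_of_sq_lt_sq ?_ hρ.le
    have : (t₀ - s₀) ^ 2 / (2 * θ) ≤ 2 * M := by linarith
    rw [div_le_iff₀ (by positivity)] at this
    linarith
  have hxδ : |2 * ε * x₀| < δ := by
    refine abs_lt_of_sq_lt_sq ?_ hδ.le
    have h1 : ε * x₀ ^ 2 ≤ 2 * M := by linarith
    nlinarith [mul_le_mul_of_nonneg_left h1 hε.le]
  have hval : σ / 2 ≤ u i₀ x₀ t₀ - v i₀ x₀ s₀ := by
    have h1 := hFj.trans hmax0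
    rw [hF] at h1
    simp only at h1
    have : 0 ≤ η * t₀ := mul_nonneg hη.le ht₀.1
    linarith
  have ht₀' : t₀ ∈ Ioc 0 T := by
    refine ⟨ht₀.1.lt_of_ne fun h => ?_, ht₀.2⟩
    subst h
    have h1 := (abs_le.1 (hδv' i₀ x₀ 0 x₀ s₀ hx₀ hx₀ ht₀ hs₀ (by
      rw [sub_self, abs_zero, zero_add]; exact hts.trans hρv))).2
    linarith [hinit i₀ x₀ hx₀]
  have hs₀' : s₀ ∈ Ioc 0 T := by
    refine ⟨hs₀.1.lt_of_ne fun h => ?_, hs₀.2⟩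
    subst h
    have h1 := (abs_le.1 (hδu' i₀ x₀ t₀ x₀ 0 hx₀ hx₀ ht₀ hs₀ (by
      rw [sub_self, abs_zero, zero_add]; exact hts.trans hρu))).2
    linarith [hinit i₀ x₀ hx₀]
  have ha : -(T / θ) ≤ (t₀ - s₀) / θ ∧ (t₀ - s₀) / θ ≤ T / θ := by
    rw [← neg_div]
    exact ⟨by gcongr; linarith [ht₀.1, hs₀.2], by gcongr; linarith [ht₀.2, hs₀.1]⟩
  refine penalized_max_false (c := η / 4) (R := R) hHcont huc hvc hujct hvjct hu hv hε.le hθ hη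
    (by positivity) hx₀ ht₀' hs₀' (i₀ := i₀) (η := η) (fun i x hx t ht s hs => ?_)
    (fun i p hp => ?_) fun i p x t hx ht hp => by linarith [hR i p x t hx ht hp, ha.1]
  · have := hmax i (x, t, s) ⟨hx, ht, hs⟩
    rwa [hF] at this
  · have hpR : |p| < R := by
      by_contra! h
      linarith [hR i p x₀ t₀ hx₀ ht₀ h, ha.1]
    have h1 := (abs_le.1 (hΛ i p x₀ t₀ s₀ hx₀ ht₀ hs₀)).1
    have h2 : Λ i * |t₀ - s₀| ≤ η / 4 := by
      rcases le_total 0 (Λ i) with h | h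
      · exact (mul_le_mul_of_nonneg_left hts.le h).trans (hρΛ i).le
      · exact (mul_nonpos_of_nonpos_of_nonneg h (abs_nonneg _)).trans (by positivity)
    have h3 := (abs_le.1 (hδH i p (p - 2 * ε * x₀) x₀ s₀ (by linarith)
      ((abs_sub _ _).trans (by linarith)) hx₀ hs₀ (by rwa [sub_sub_cancel]))).1
    linarith

/-- **Comparison principle for the one-dimensional Kirchhoff junction problem
(Theorem 2.1).** Assume each `H_i` is continuous on `ℝ × (-∞,0] × [0,T]`, coercive
in `p` uniformly in `(x,t)`, uniformly continuous in `(p,x,t)` for bounded `p`, and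
Lipschitz in `t`. If `u` is a bounded uniformly continuous generalized viscosity
subsolution and `v` a bounded uniformly continuous generalized viscosity supersolution
with the same constant `B`, and `u_i(·,0) ≤ v_i(·,0)` on `(-∞,0]` for every `i`, then
`u_i ≤ v_i` on `(-∞,0] × [0,T]` for every `i`. -/
theorem kirchhoff_comparison
    (K : ℕ) (hK : 0 < K) (T B : ℝ) (hT : 0 < T)
    (H : Fin K → ℝ → ℝ → ℝ → ℝ)
    (hHcont : ∀ i, ContinuousOn (fun q : ℝ × ℝ × ℝ => H i q.1 q.2.1 q.2.2)
      {q : ℝ × ℝ × ℝ | q.2.1 ≤ 0 ∧ q.2.2 ∈ Set.Icc 0 T})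
    (hHcoer : ∀ i, ∀ M : ℝ, ∃ R : ℝ, ∀ p x t : ℝ, x ≤ 0 → t ∈ Set.Icc 0 T →
      R ≤ |p| → M ≤ H i p x t)
    (hHuc : ∀ i, ∀ R > (0 : ℝ), ∀ ε > (0 : ℝ), ∃ δ > (0 : ℝ),
      ∀ p₁ x₁ t₁ p₂ x₂ t₂ : ℝ, |p₁| ≤ R → |p₂| ≤ R → x₁ ≤ 0 → x₂ ≤ 0 →
        t₁ ∈ Set.Icc 0 T → t₂ ∈ Set.Icc 0 T →
        |p₁ - p₂| + |x₁ - x₂| + |t₁ - t₂| < δ →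
        |H i p₁ x₁ t₁ - H i p₂ x₂ t₂| ≤ ε)
    (hHlip : ∀ i, ∃ Λ : ℝ, ∀ p x t₁ t₂ : ℝ, x ≤ 0 →
      t₁ ∈ Set.Icc 0 T → t₂ ∈ Set.Icc 0 T →
      |H i p x t₁ - H i p x t₂| ≤ Λ * |t₁ - t₂|)
    (u v : Fin K → ℝ → ℝ → ℝ)
    -- u and v are bounded on the domain
    (hubd : ∃ M : ℝ, ∀ i x t, x ≤ 0 → t ∈ Set.Icc 0 T → |u i x t| ≤ M)
    (hvbd : ∃ M : ℝ, ∀ i x t, x ≤ 0 → t ∈ Set.Icc 0 T → |v i x t| ≤ M)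
    -- u and v are uniformly continuous on the domain
    (huuc : ∀ ε > (0 : ℝ), ∃ δ > (0 : ℝ), ∀ i : Fin K, ∀ x₁ t₁ x₂ t₂ : ℝ,
      x₁ ≤ 0 → x₂ ≤ 0 → t₁ ∈ Set.Icc 0 T → t₂ ∈ Set.Icc 0 T →
      |x₁ - x₂| + |t₁ - t₂| < δ → |u i x₁ t₁ - u i x₂ t₂| ≤ ε)
    (hvuc : ∀ ε > (0 : ℝ), ∃ δ > (0 : ℝ), ∀ i : Fin K, ∀ x₁ t₁ x₂ t₂ : ℝ,
      x₁ ≤ 0 → x₂ ≤ 0 → t₁ ∈ Set.Icc 0 T → t₂ ∈ Set.Icc 0 T →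
      |x₁ - x₂| + |t₁ - t₂| < δ → |v i x₁ t₁ - v i x₂ t₂| ≤ ε)
    -- all branches agree at the junction point
    (hujct : ∀ i j : Fin K, ∀ t ∈ Set.Icc (0 : ℝ) T, u i 0 t = u j 0 t)
    (hvjct : ∀ i j : Fin K, ∀ t ∈ Set.Icc (0 : ℝ) T, v i 0 t = v j 0 t)
    -- u is a generalized subsolution and v a generalized supersolution
    (hu : KirchhoffSubsolution hK T B H u)
    (hv : KirchhoffSupersolution hK T B H v)
    -- ordered initial data
    (hinit : ∀ i : Fin K, ∀ x ≤ (0 : ℝ), u i x 0 ≤ v i x 0) :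
    ∀ i : Fin K, ∀ x t : ℝ, x ≤ 0 → t ∈ Set.Icc 0 T → u i x t ≤ v i x t := by
  obtain ⟨Mu, hMu⟩ := hubd
  obtain ⟨Mv, hMv⟩ := hvbd
  have hue : ∀ i, ∀ x ≤ 0, ∀ t ∈ Icc 0 T, clampExtend T (u i) x t = u i x t :=
    fun i x hx t ht => clampExtend_eq (u i) hx ht
  have hve : ∀ i, ∀ x ≤ 0, ∀ t ∈ Icc 0 T, clampExtend T (v i) x t = v i x t :=
    fun i x hx t ht => clampExtend_eq (v i) hx ht
  have h0T : (0 : ℝ) ∈ Icc 0 T := ⟨le_rfl, hT.le⟩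
  intro i x t hx ht
  rw [← hue i x hx t ht, ← hve i x hx t ht]
  refine kirchhoff_comparison_of_continuous (M := max Mu Mv)
    (u := fun i => clampExtend T (u i)) (v := fun i => clampExtend T (v i))
    hHcont hHcoer hHuc hHlip
    (fun i => continuous_clampExtend hT fun ε hε => (huuc ε hε).imp fun δ h => ⟨h.1, h.2 i⟩)
    (fun i => continuous_clampExtend hT fun ε hε => (hvuc ε hε).imp fun δ h => ⟨h.1, h.2 i⟩)
    (fun i x t hx ht => ?_) (fun i x t hx ht => ?_) (fun ε hε => ?_) (fun ε hε => ?_)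
    (fun i j t ht => ?_) (fun i j t ht => ?_) (hu.congr hue) (hv.congr hve) (fun i x hx => ?_)
    i x t hx ht
  · rw [hue i x hx t ht]
    exact (hMu i x t hx ht).trans (le_max_left _ _)
  · rw [hve i x hx t ht]
    exact (hMv i x t hx ht).trans (le_max_right _ _)
  · obtain ⟨δ, hδ, h⟩ := huuc ε hε
    refine ⟨δ, hδ, fun i x₁ t₁ x₂ t₂ hx₁ hx₂ ht₁ ht₂ hd => ?_⟩
    rw [hue i x₁ hx₁ t₁ ht₁, hue i x₂ hx₂ t₂ ht₂]
    exact h i x₁ t₁ x₂ t₂ hx₁ hx₂ ht₁ ht₂ hd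
  · obtain ⟨δ, hδ, h⟩ := hvuc ε hε
    refine ⟨δ, hδ, fun i x₁ t₁ x₂ t₂ hx₁ hx₂ ht₁ ht₂ hd => ?_⟩
    rw [hve i x₁ hx₁ t₁ ht₁, hve i x₂ hx₂ t₂ ht₂]
    exact h i x₁ t₁ x₂ t₂ hx₁ hx₂ ht₁ ht₂ hd
  · rw [hue i 0 le_rfl t ht, hue j 0 le_rfl t ht]
    exact hujct i j t ht
  · rw [hve i 0 le_rfl t ht, hve j 0 le_rfl t ht]
    exact hvjct i j t ht
  · rw [hue i x hx 0 h0T, hve i x hx 0 h0T]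
    exact hinit i x hx
end

section
/- Stability of the Kirchhoff junction problem under vanishing viscosity: assume each Hamiltonian H_i : ℝ × (-∞,0] × [0,T] → ℝ is continuous, coercive in its first argument p uniformly in (x,t), uniformly continuous in (p,x,t) on sets where p is bounded, and Lipschitz continuous in t. For ε > 0 let u_ε = (u_{1,ε},…,u_{K,ε}) be classical solutions (each u_{i,ε} continuous on (-∞,0] × [0,T], twice continuously differentiable in x and once in t up to the boundary, with common value at x = 0) of ∂_t u_{i,ε} − ε ∂_{xx} u_{i,ε} + H_i(∂_x u_{i,ε}, x, t) = 0 in (-∞,0) × (0,T] for every i, together with the Kirchhoff boundary condition Σ_{i=1}^K ∂_x u_{i,ε}(0,t) = B for all t ∈ (0,T]. If, along a sequence ε_n → 0⁺, u_{ε_n} converges locally uniformly on (-∞,0] × [0,T] (branchwise) to a continuous function u, then u is a generalized viscosity solution of the Kirchhoff junction problem with constant B. -/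
open Set Filter

theorem HasDerivWithinAt.nonneg_of_eventually_le {f : ℝ → ℝ} {f' b : ℝ}
    (hf : HasDerivWithinAt f f' (Iio b) b) (hmax : ∀ᶠ y in nhdsWithin b (Iio b), f y ≤ f b) :
    0 ≤ f' := by
  rw [hasDerivWithinAt_iff_tendsto_slope' (by simp)] at hf
  refine ge_of_tendsto hf ?_
  filter_upwards [hmax, self_mem_nhdsWithin] with y hy hyb
  rw [slope_def_field]
  exact div_nonneg_of_nonpos (by linarith) (by linarith [mem_Iio.1 hyb])

theorem IsLocalMax.second_deriv_nonpos {f f' : ℝ → ℝ} {x f'' : ℝ} (hmax : IsLocalMax f x)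
    (hf : ∀ᶠ y in nhds x, HasDerivAt f (f' y) y) (hf' : HasDerivAt f' f'' x) : f'' ≤ 0 := by
  by_contra! hpos
  have hd : deriv f =ᶠ[nhds x] f' := hf.mono fun y hy => hy.deriv
  have hdd : deriv (deriv f) x = f'' := by rw [hd.deriv_eq, hf'.deriv]
  have hmin : IsLocalMin f x :=
    isLocalMin_of_deriv_deriv_pos (hdd ▸ hpos) hmax.deriv_eq_zero hf.self_of_nhds.continuousAt
  have hconst : f =ᶠ[nhds x] fun _ => f x := by
    filter_upwards [hmax, hmin] with y h₁ h₂ using le_antisymm h₁ h₂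
  have h0 : deriv f =ᶠ[nhds x] fun _ => 0 := by
    filter_upwards [hconst.eventuallyEq_nhds] with y hy
    rw [hy.deriv_eq, deriv_const]
  rw [h0.deriv_eq, deriv_const] at hdd
  exact hpos.ne hdd

/-- Maximisers of a family of uniform perturbations stay away from a set on which the
unperturbed family lies uniformly below its value at a reference point. -/
theorem exists_forall_le_notMem_of_gap {ι X : Type*} [Finite ι] [Nonempty ι] [TopologicalSpace X]
    {S F : Set X} (hS : IsCompact S) {q₀ : X} (hq₀ : q₀ ∈ S) {w w' : ι → X → ℝ} {c g : ℝ}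
    (hw₀ : ∀ i, w i q₀ = c) (hgap : ∀ i, ∀ q ∈ S, q ∈ F → w i q ≤ c - 2 * g)
    (hw' : ∀ i, ContinuousOn (w' i) S) (hclose : ∀ i, ∀ q ∈ S, |w' i q - w i q| < g) :
    ∃ i, ∃ q ∈ S, q ∉ F ∧ ∀ j, ∀ q' ∈ S, w' j q' ≤ w' i q := by
  have hex : ∀ i, ∃ q ∈ S, ∀ q' ∈ S, w' i q' ≤ w' i q := fun i =>
    hS.exists_isMaxOn ⟨q₀, hq₀⟩ (hw' i)
  choose m hmS hm using hex
  obtain ⟨i, hi⟩ := Finite.exists_max fun i => w' i (m i)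
  have hle : ∀ j, ∀ q' ∈ S, w' j q' ≤ w' i (m i) := fun j q' hq' => (hm j q' hq').trans (hi j)
  refine ⟨i, m i, hmS i, fun hF => ?_, hle⟩
  have h₁ := hgap i _ (hmS i) hF
  have h₂ := abs_lt.1 (hclose i _ (hmS i))
  have h₃ := abs_lt.1 (hclose i _ hq₀)
  have h₄ := hle i _ hq₀
  have h₅ := hw₀ i
  linarith

theorem isCompact_jdom_inter_ball (T x₀ t₀ r : ℝ) :
    IsCompact (JDom T ∩ {q | |q.1 - x₀| + |q.2 - t₀| ≤ r}) := by
  have hclosed : IsClosed (JDom T ∩ {q | |q.1 - x₀| + |q.2 - t₀| ≤ r}) := by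
    refine IsClosed.inter (IsClosed.inter ?_ ?_) ?_
    · exact isClosed_le continuous_fst continuous_const
    · exact isClosed_Icc.preimage continuous_snd
    · exact isClosed_le (by fun_prop) continuous_const
  refine (isCompact_closedBall (x₀, t₀) r).of_isClosed_subset hclosed fun q hq => ?_
  rw [Metric.mem_closedBall, Prod.dist_eq, max_le_iff, Real.dist_eq, Real.dist_eq]
  have h := hq.2
  rw [mem_ofPred_eq] at h
  exact ⟨by linarith [abs_nonneg (q.2 - t₀)], by linarith [abs_nonneg (q.1 - x₀)]⟩

theorem exists_uniform_pos_of_continuousOn {T : ℝ} {h : ℝ → ℝ → ℝ → ℝ}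
    (hh : ContinuousOn (fun q : ℝ × ℝ × ℝ => h q.1 q.2.1 q.2.2)
      {q : ℝ × ℝ × ℝ | q.2.1 ≤ 0 ∧ q.2.2 ∈ Icc 0 T})
    {x₀ t₀ p a : ℝ} (hx₀ : x₀ ≤ 0) (ht₀ : t₀ ∈ Icc 0 T) (hpos : 0 < a + h p x₀ t₀) :
    ∃ d > 0, ∀ d' ≤ d, ∀ s e p' x t : ℝ, |s - a| ≤ d' → |e| ≤ d' → |p' - p| ≤ d' →
      |x - x₀| ≤ d' → |t - t₀| ≤ d' → x ≤ 0 → t ∈ Icc 0 T → 0 < s + h p' x t - e := by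
  have hc := hh (p, x₀, t₀) ⟨hx₀, ht₀⟩
  obtain ⟨δ, hδ, hδh⟩ := Metric.continuousWithinAt_iff.1 hc ((a + h p x₀ t₀) / 4) (by linarith)
  refine ⟨min (δ / 2) ((a + h p x₀ t₀) / 4), by positivity, ?_⟩
  intro d' hd' s e p' x t hs he hp hx ht hx0 htT
  have h₁ := hd'.trans (min_le_left _ _)
  have h₂ := hd'.trans (min_le_right _ _)
  have h₃ := @hδh (p', x, t) ⟨hx0, htT⟩ (by
    simp only [Prod.dist_eq, Real.dist_eq, max_lt_iff]
    exact ⟨by linarith, by linarith, by linarith⟩)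
  rw [Real.dist_eq] at h₃
  have h₄ := abs_lt.1 h₃
  have h₅ := abs_le.1 hs
  have h₆ := abs_le.1 he
  simp only at h₄
  linarith

theorem sq_add_sq_gap {x t r η : ℝ} (hr : 0 < r) (hη : 0 < η) (h : r ≤ |x| + |t|)
    (h' : |x| + |t| ≤ r) :
    η * (|x| + |t|) + 2 * (η * r / 2) ≤ 4 * η / r * (x ^ 2 + t ^ 2) := by
  have he : |x| + |t| = r := le_antisymm h' h
  have hsq : r ^ 2 ≤ 2 * (x ^ 2 + t ^ 2) := by
    rw [← he, ← sq_abs x, ← sq_abs t]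
    nlinarith [sq_nonneg (|x| - |t|)]
  rw [he, div_mul_eq_mul_div, le_div_iff₀ hr]
  nlinarith

/-- At a maximum of the difference of a classical solution of the viscous equation and a
quadratic polynomial, the polynomial satisfies the subsolution inequality. -/
theorem viscous_ineq_of_local_max {T ε : ℝ} (hε : 0 < ε) {h : ℝ → ℝ → ℝ → ℝ}
    {v vx vxx vt : ℝ → ℝ → ℝ}
    (hdx : ∀ x ≤ (0 : ℝ), ∀ t ∈ Icc (0 : ℝ) T,
      HasDerivWithinAt (fun y => v y t) (vx x t) (Iic 0) x)
    (hdxx : ∀ x ≤ (0 : ℝ), ∀ t ∈ Icc (0 : ℝ) T,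
      HasDerivWithinAt (fun y => vx y t) (vxx x t) (Iic 0) x)
    (hdt : ∀ x ≤ (0 : ℝ), ∀ t ∈ Icc (0 : ℝ) T,
      HasDerivWithinAt (fun s => v x s) (vt x t) (Icc 0 T) t)
    {x t x₀ t₀ p a C : ℝ} (hx : x < 0) (ht : t ∈ Ioc 0 T)
    (hpde : vt x t - ε * vxx x t + h (vx x t) x t ≤ 0)
    (hmax : ∀ᶠ q in nhdsWithin (x, t) (JDom T),
      v q.1 q.2 - (p * (q.1 - x₀) + a * (q.2 - t₀) + C * ((q.1 - x₀) ^ 2 + (q.2 - t₀) ^ 2)) ≤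
      v x t - (p * (x - x₀) + a * (t - t₀) + C * ((x - x₀) ^ 2 + (t - t₀) ^ 2))) :
    a + 2 * C * (t - t₀) + h (p + 2 * C * (x - x₀)) x t - ε * (2 * C) ≤ 0 := by
  have htI : t ∈ Icc 0 T := Ioc_subset_Icc_self ht
  have hmaxx : IsLocalMax (fun y => v y t - (p * (y - x₀) + C * (y - x₀) ^ 2)) x := by
    have hc : Tendsto (fun y : ℝ => (y, t)) (nhds x) (nhdsWithin (x, t) (JDom T)) := by
      refine tendsto_nhdsWithin_iff.2 ⟨(by fun_prop : Continuous fun y : ℝ => (y, t)).tendsto x, ?_⟩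
      filter_upwards [Iio_mem_nhds hx] with y hy using ⟨le_of_lt hy, htI⟩
    filter_upwards [hc.eventually hmax] with y hy
    linarith
  have hmaxt : ∀ᶠ s in nhdsWithin t (Iio t),
      v x s - (a * (s - t₀) + C * (s - t₀) ^ 2) ≤ v x t - (a * (t - t₀) + C * (t - t₀) ^ 2) := by
    have hc : Tendsto (fun s : ℝ => (x, s)) (nhdsWithin t (Iio t))
        (nhdsWithin (x, t) (JDom T)) := by
      refine tendsto_nhdsWithin_iff.2
        ⟨((by fun_prop : Continuous fun s : ℝ => (x, s)).tendsto t).mono_left inf_le_left, ?_⟩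
      filter_upwards [Icc_mem_nhdsLT_of_mem ht] with s hs using ⟨hx.le, hs⟩
    filter_upwards [hc.eventually hmax] with s hs
    linarith
  have hD : ∀ y < 0, HasDerivAt (fun y => v y t - (p * (y - x₀) + C * (y - x₀) ^ 2))
      (vx y t - (p + 2 * C * (y - x₀))) y := by
    intro y hy
    have h₁ := (hdx y hy.le t htI).hasDerivAt (Iic_mem_nhds hy)
    have h₂ : HasDerivAt (fun y : ℝ => y - x₀) 1 y := (hasDerivAt_id y).sub_const x₀
    refine (h₁.sub ((h₂.const_mul p).add ((h₂.pow 2).const_mul C))).congr_deriv ?_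
    simp
    ring
  have hvx : vx x t = p + 2 * C * (x - x₀) := by
    linarith [hmaxx.hasDerivAt_eq_zero (hD x hx)]
  have hvxx : vxx x t ≤ 2 * C := by
    have h₂ : HasDerivAt (fun y : ℝ => y - x₀) 1 x := (hasDerivAt_id x).sub_const x₀
    have h₁ := ((hdxx x hx.le t htI).hasDerivAt (Iic_mem_nhds hx)).sub
      ((h₂.const_mul (2 * C)).const_add p)
    have h₃ := hmaxx.second_deriv_nonpos
      (by filter_upwards [Iio_mem_nhds hx] with y hy using hD y hy) h₁
    linarith
  have hvt : a + 2 * C * (t - t₀) ≤ vt x t := by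
    have h₂ : HasDerivWithinAt (fun s : ℝ => s - t₀) 1 (Iio t) t :=
      (hasDerivWithinAt_id t _).sub_const t₀
    have h₁ := ((hdt x hx.le t htI).mono_of_mem_nhdsWithin (Icc_mem_nhdsLT_of_mem ht)).sub
      ((h₂.const_mul a).add ((h₂.pow 2).const_mul C))
    have h₃ := h₁.nonneg_of_eventually_le hmaxt
    simp at h₃
    linarith
  rw [← hvx]
  nlinarith [mul_le_mul_of_nonneg_left hvxx hε.le]

theorem superjet_ineq_of_tendsto {ι : Type*} [Fintype ι] [Nonempty ι] {T B : ℝ}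
    {H : ι → ℝ → ℝ → ℝ → ℝ}
    (hHcont : ∀ i, ContinuousOn (fun q : ℝ × ℝ × ℝ => H i q.1 q.2.1 q.2.2)
      {q : ℝ × ℝ × ℝ | q.2.1 ≤ 0 ∧ q.2.2 ∈ Icc 0 T})
    {ε : ℕ → ℝ} (hε : ∀ n, 0 < ε n) (hε0 : Tendsto ε atTop (nhds 0))
    {un unx unxx unt : ℕ → ι → ℝ → ℝ → ℝ}
    (huncont : ∀ n i, ContinuousOn (fun q : ℝ × ℝ => un n i q.1 q.2) (JDom T))
    (hdx : ∀ n i, ∀ x ≤ (0 : ℝ), ∀ t ∈ Icc (0 : ℝ) T,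
      HasDerivWithinAt (fun y => un n i y t) (unx n i x t) (Iic 0) x)
    (hdxx : ∀ n i, ∀ x ≤ (0 : ℝ), ∀ t ∈ Icc (0 : ℝ) T,
      HasDerivWithinAt (fun y => unx n i y t) (unxx n i x t) (Iic 0) x)
    (hdt : ∀ n i, ∀ x ≤ (0 : ℝ), ∀ t ∈ Icc (0 : ℝ) T,
      HasDerivWithinAt (fun s => un n i x s) (unt n i x t) (Icc 0 T) t)
    (hpde : ∀ n i, ∀ x < (0 : ℝ), ∀ t ∈ Ioc (0 : ℝ) T,
      unt n i x t - ε n * unxx n i x t + H i (unx n i x t) x t ≤ 0)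
    {u : ι → ℝ → ℝ → ℝ}
    (hconv : ∀ i, TendstoLocallyUniformlyOn (fun n (q : ℝ × ℝ) => un n i q.1 q.2)
      (fun q : ℝ × ℝ => u i q.1 q.2) atTop (JDom T))
    {x₀ t₀ a c : ℝ} {p : ι → ℝ} (hx₀ : x₀ ≤ 0) (ht₀ : t₀ ∈ Ioc 0 T)
    (hkirchhoff : x₀ = 0 → ∀ n, ∀ t ∈ Ioc (0 : ℝ) T, ∑ i, unx n i 0 t ≤ B)
    (hunjct : x₀ = 0 → ∀ n, ∀ i j, ∀ t ∈ Icc (0 : ℝ) T, un n i 0 t = un n j 0 t)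
    (hc : ∀ i, u i x₀ t₀ = c)
    (hjet : ∀ i, ∀ η > (0 : ℝ), ∃ δ > (0 : ℝ), ∀ x t : ℝ, x ≤ 0 → t ∈ Icc 0 T →
      |x - x₀| + |t - t₀| < δ →
      u i x t ≤ c + p i * (x - x₀) + a * (t - t₀) + η * (|x - x₀| + |t - t₀|)) :
    (x₀ = 0 ∧ ∑ i, p i ≤ B) ∨ ∃ i, a + H i (p i) x₀ t₀ ≤ 0 := by
  by_contra! hcon
  obtain ⟨hB, hpos⟩ := hcon
  have ht₀I : t₀ ∈ Icc 0 T := Ioc_subset_Icc_self ht₀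
  choose d hd hdH using fun i =>
    exists_uniform_pos_of_continuousOn (hHcont i) hx₀ ht₀I (hpos i)
  obtain ⟨i₁, hi₁⟩ := Finite.exists_min d
  have hη : 0 < d i₁ / 8 := by linarith [hd i₁]
  set η := d i₁ / 8 with hηdef
  choose δ hδ hδu using fun i => hjet i η hη
  obtain ⟨i₂, hi₂⟩ := Finite.exists_min δ
  obtain ⟨r, hr, hrd, hrδ, hrt, hrx⟩ : ∃ r > 0, r ≤ d i₁ ∧ r < δ i₂ ∧ r < t₀ ∧
      (x₀ < 0 → r < -x₀) := by
    have ht := ht₀.1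
    rcases hx₀.lt_or_eq with hx | hx
    · have hm : 0 < min (min (d i₁) (δ i₂)) (min t₀ (-x₀)) :=
        lt_min (lt_min (hd _) (hδ _)) (lt_min ht (by linarith))
      refine ⟨min (min (d i₁) (δ i₂)) (min t₀ (-x₀)) / 2, by linarith, ?_⟩
      have h₁ := (min_le_left (min (d i₁) (δ i₂)) (min t₀ (-x₀)))
      have h₂ := (min_le_right (min (d i₁) (δ i₂)) (min t₀ (-x₀)))
      rw [le_min_iff] at h₁ h₂
      exact ⟨by linarith, by linarith, by linarith, fun _ => by linarith⟩
    · have hm : 0 < min (min (d i₁) (δ i₂)) t₀ := lt_min (lt_min (hd _) (hδ _)) ht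
      refine ⟨min (min (d i₁) (δ i₂)) t₀ / 2, by linarith, ?_⟩
      have h₁ := (min_le_left (min (d i₁) (δ i₂)) t₀)
      have h₂ := (min_le_right (min (d i₁) (δ i₂)) t₀)
      rw [le_min_iff] at h₁
      exact ⟨by linarith, by linarith, by linarith, fun h => by linarith⟩
  set C := 4 * η / r with hC
  have hC0 : 0 < C := by positivity
  have hCr : 2 * C * r = d i₁ := by
    rw [hC, hηdef]; field_simp; ring
  set S := JDom T ∩ {q : ℝ × ℝ | |q.1 - x₀| + |q.2 - t₀| ≤ r} with hSdef
  have hS : IsCompact S := isCompact_jdom_inter_ball T x₀ t₀ r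
  have hg : 0 < η * r / 2 := by positivity
  have hunif : ∀ᶠ n in atTop, ∀ i, ∀ q ∈ S, |un n i q.1 q.2 - u i q.1 q.2| < η * r / 2 := by
    refine eventually_all.2 fun i => ?_
    have h := (tendstoLocallyUniformlyOn_iff_tendstoUniformlyOn_of_compact hS).1
      ((hconv i).mono inter_subset_left)
    filter_upwards [Metric.tendstoUniformlyOn_iff.1 h _ hg] with n hn q hq
    have := hn q hq
    rwa [dist_comm, Real.dist_eq] at this
  have hsmall : ∀ᶠ n in atTop, ε n * (2 * C) < d i₁ := by
    have h : Tendsto (fun n => ε n * (2 * C)) atTop (nhds (0 * (2 * C))) := hε0.mul_const _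
    rw [zero_mul] at h
    exact h.eventually_lt_const (hd i₁)
  obtain ⟨n, hn, hnε⟩ := (hunif.and hsmall).exists
  let ψ : ι → ℝ × ℝ → ℝ := fun i q =>
    p i * (q.1 - x₀) + a * (q.2 - t₀) + C * ((q.1 - x₀) ^ 2 + (q.2 - t₀) ^ 2)
  obtain ⟨i, ⟨x, t⟩, hqS, hqF, hmax⟩ := exists_forall_le_notMem_of_gap
    (F := {q : ℝ × ℝ | r ≤ |q.1 - x₀| + |q.2 - t₀|}) hS (q₀ := (x₀, t₀))
    (w := fun i q => u i q.1 q.2 - ψ i q) (w' := fun i q => un n i q.1 q.2 - ψ i q) (c := c)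
    (g := η * r / 2) ⟨⟨hx₀, ht₀I⟩, by simp [hr.le]⟩ (fun i => by simp [ψ, hc])
    (fun i q hq hF => by
      have h₁ := sq_add_sq_gap hr hη hF hq.2
      have h₂ := hδu i q.1 q.2 hq.1.1 hq.1.2 (lt_of_le_of_lt hq.2 (hrδ.trans_le (hi₂ i)))
      simp only [ψ]
      linarith)
    (fun i => ((huncont n i).mono inter_subset_left).sub (by fun_prop))
    (fun i q hq => by simpa using hn i q hq)
  have hlt : |x - x₀| + |t - t₀| < r := not_le.1 hqF
  have hx : x ≤ 0 := hqS.1.1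
  have hxr : |x - x₀| < r := by linarith [abs_nonneg (t - t₀)]
  have htr : |t - t₀| < r := by linarith [abs_nonneg (x - x₀)]
  have ht : t ∈ Ioc 0 T := ⟨by linarith [(abs_lt.1 htr).1], hqS.1.2.2⟩
  have hopen : ∀ᶠ q : ℝ × ℝ in nhds (x, t), |q.1 - x₀| + |q.2 - t₀| < r :=
    (isOpen_lt (by fun_prop) continuous_const).mem_nhds hlt
  rcases hx.lt_or_eq with hx0 | rfl
  · have h₁ := viscous_ineq_of_local_max (hε n) (hdx n i) (hdxx n i) (hdt n i) hx0 ht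
      (hpde n i x hx0 t ht) (x₀ := x₀) (t₀ := t₀) (p := p i) (a := a) (C := C) (by
        filter_upwards [hopen.filter_mono inf_le_left, self_mem_nhdsWithin] with q hq hqJ
        exact hmax i q ⟨hqJ, hq.le⟩)
    have hb : ∀ y, |y| < r → |2 * C * y| ≤ d i₁ := fun y hy => by
      rw [abs_mul, abs_of_pos (by positivity : 0 < 2 * C), ← hCr]
      gcongr
    have h₂ := hdH i (d i₁) (hi₁ i) (a + 2 * C * (t - t₀)) (ε n * (2 * C))
      (p i + 2 * C * (x - x₀)) x t (by simpa using hb _ htr)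
      (by rw [abs_of_pos (mul_pos (hε n) (by positivity))]; exact hnε.le)
      (by simpa using hb _ hxr) (by linarith) (by linarith) hx hqS.1.2
    linarith
  · have hx₀0 : x₀ = 0 := by
      by_contra hne
      have hneg := lt_of_le_of_ne hx₀ hne
      have := hrx hneg
      rw [zero_sub, abs_of_pos (by linarith)] at hxr
      linarith
    subst hx₀0
    have hpx : ∀ j, p j ≤ unx n j 0 t := by
      intro j
      have h₂ : HasDerivWithinAt (fun y : ℝ => y) 1 (Iio 0) 0 := hasDerivWithinAt_id 0 _
      have h₁ := ((hdx n j 0 le_rfl t hqS.1.2).mono Iio_subset_Iic_self).sub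
        ((h₂.const_mul (p j)).add ((h₂.pow 2).const_mul C))
      have hev : ∀ᶠ y in nhdsWithin (0 : ℝ) (Iio 0), |y - 0| + |t - t₀| < r :=
        ((by fun_prop : Continuous fun y : ℝ => (y, t)).tendsto 0 |>.eventually hopen).filter_mono
          inf_le_left
      have h₃ := h₁.nonneg_of_eventually_le (by
        filter_upwards [hev, self_mem_nhdsWithin] with y hy hy0
        have h₄ := hmax j (y, t) ⟨⟨le_of_lt hy0, hqS.1.2⟩, hy.le⟩
        have h₅ := hunjct rfl n i j t hqS.1.2
        simp only [ψ] at h₄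
        simp
        linarith)
      simp at h₃
      linarith
    have h₁ := Finset.sum_le_sum fun j (_ : j ∈ Finset.univ) => hpx j
    linarith [hkirchhoff rfl n t ht, hB rfl]

theorem viscSubIn_of_tendsto {T : ℝ} {H : ℝ → ℝ → ℝ → ℝ}
    (hHcont : ContinuousOn (fun q : ℝ × ℝ × ℝ => H q.1 q.2.1 q.2.2)
      {q : ℝ × ℝ × ℝ | q.2.1 ≤ 0 ∧ q.2.2 ∈ Icc 0 T})
    {ε : ℕ → ℝ} (hε : ∀ n, 0 < ε n) (hε0 : Tendsto ε atTop (nhds 0))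
    {un unx unxx unt : ℕ → ℝ → ℝ → ℝ}
    (huncont : ∀ n, ContinuousOn (fun q : ℝ × ℝ => un n q.1 q.2) (JDom T))
    (hdx : ∀ n, ∀ x ≤ (0 : ℝ), ∀ t ∈ Icc (0 : ℝ) T,
      HasDerivWithinAt (fun y => un n y t) (unx n x t) (Iic 0) x)
    (hdxx : ∀ n, ∀ x ≤ (0 : ℝ), ∀ t ∈ Icc (0 : ℝ) T,
      HasDerivWithinAt (fun y => unx n y t) (unxx n x t) (Iic 0) x)
    (hdt : ∀ n, ∀ x ≤ (0 : ℝ), ∀ t ∈ Icc (0 : ℝ) T,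
      HasDerivWithinAt (fun s => un n x s) (unt n x t) (Icc 0 T) t)
    (hpde : ∀ n, ∀ x < (0 : ℝ), ∀ t ∈ Ioc (0 : ℝ) T,
      unt n x t - ε n * unxx n x t + H (unx n x t) x t ≤ 0)
    {u : ℝ → ℝ → ℝ}
    (hconv : TendstoLocallyUniformlyOn (fun n (q : ℝ × ℝ) => un n q.1 q.2)
      (fun q : ℝ × ℝ => u q.1 q.2) atTop (JDom T)) :
    ViscSubIn T H u := by
  intro φ x₀ t₀ hx₀ ht₀ ht₀T hφ hmax
  have key := superjet_ineq_of_tendsto (ι := Unit) (B := 0) (fun _ => hHcont) hε hε0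
    (un := fun n _ => un n) (unx := fun n _ => unx n) (unxx := fun n _ => unxx n)
    (unt := fun n _ => unt n) (fun n _ => huncont n) (fun n _ => hdx n) (fun n _ => hdxx n)
    (fun n _ => hdt n) (fun n _ => hpde n) (u := fun _ => u) (fun _ => hconv)
    (a := fderiv ℝ φ (x₀, t₀) (0, 1)) (c := u x₀ t₀)
    (p := fun _ => fderiv ℝ φ (x₀, t₀) (1, 0)) hx₀.le ⟨ht₀, ht₀T⟩
    (fun h => absurd h hx₀.ne) (fun h => absurd h hx₀.ne) (fun _ => rfl) (fun _ η hη => by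
      have hd := ((hφ.differentiable one_ne_zero) (x₀, t₀)).hasFDerivAt
      have hev := (hd.isLittleO.def hη).filter_mono
        (inf_le_left : nhdsWithin (x₀, t₀) (JDom T) ≤ _)
      obtain ⟨δ, hδ, hball⟩ := Metric.mem_nhdsWithin_iff.1 (hev.and hmax)
      refine ⟨δ, hδ, fun x t hx ht hlt => ?_⟩
      have hx' := abs_nonneg (x - x₀)
      have ht' := abs_nonneg (t - t₀)
      obtain ⟨h₁, h₂⟩ := @hball (x, t) ⟨by
        rw [Metric.mem_ball, Prod.dist_eq, max_lt_iff, Real.dist_eq, Real.dist_eq]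
        exact ⟨by linarith, by linarith⟩, hx, ht⟩
      have hL : fderiv ℝ φ (x₀, t₀) ((x, t) - (x₀, t₀)) =
          fderiv ℝ φ (x₀, t₀) (1, 0) * (x - x₀) + fderiv ℝ φ (x₀, t₀) (0, 1) * (t - t₀) := by
        have : ((x, t) - (x₀, t₀) : ℝ × ℝ) = (x - x₀) • (1, 0) + (t - t₀) • (0, 1) := by
          ext <;> simp
        rw [this, map_add, map_smul, map_smul, smul_eq_mul, smul_eq_mul]
        ring
      have hnorm : ‖((x, t) - (x₀, t₀) : ℝ × ℝ)‖ ≤ |x - x₀| + |t - t₀| := by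
        rw [Prod.norm_def]
        exact max_le (by simp) (by simp)
      have h₃ := (h₁.trans (mul_le_mul_of_nonneg_left hnorm hη.le))
      rw [hL, Real.norm_eq_abs] at h₃
      have h₄ := (abs_le.1 h₃).2
      simp only at h₂
      linarith)
  rcases key with ⟨h, _⟩ | ⟨_, h⟩
  · exact absurd h hx₀.ne
  · exact h

theorem kirchhoffSubsolution_of_tendsto {K : ℕ} (hK : 0 < K) {T B : ℝ}
    {H : Fin K → ℝ → ℝ → ℝ → ℝ}
    (hHcont : ∀ i, ContinuousOn (fun q : ℝ × ℝ × ℝ => H i q.1 q.2.1 q.2.2)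
      {q : ℝ × ℝ × ℝ | q.2.1 ≤ 0 ∧ q.2.2 ∈ Icc 0 T})
    {ε : ℕ → ℝ} (hε : ∀ n, 0 < ε n) (hε0 : Tendsto ε atTop (nhds 0))
    {un unx unxx unt : ℕ → Fin K → ℝ → ℝ → ℝ}
    (huncont : ∀ n i, ContinuousOn (fun q : ℝ × ℝ => un n i q.1 q.2) (JDom T))
    (hdx : ∀ n i, ∀ x ≤ (0 : ℝ), ∀ t ∈ Icc (0 : ℝ) T,
      HasDerivWithinAt (fun y => un n i y t) (unx n i x t) (Iic 0) x)
    (hdxx : ∀ n i, ∀ x ≤ (0 : ℝ), ∀ t ∈ Icc (0 : ℝ) T,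
      HasDerivWithinAt (fun y => unx n i y t) (unxx n i x t) (Iic 0) x)
    (hdt : ∀ n i, ∀ x ≤ (0 : ℝ), ∀ t ∈ Icc (0 : ℝ) T,
      HasDerivWithinAt (fun s => un n i x s) (unt n i x t) (Icc 0 T) t)
    (hpde : ∀ n i, ∀ x < (0 : ℝ), ∀ t ∈ Ioc (0 : ℝ) T,
      unt n i x t - ε n * unxx n i x t + H i (unx n i x t) x t ≤ 0)
    (hkirchhoff : ∀ n, ∀ t ∈ Ioc (0 : ℝ) T, ∑ i, unx n i 0 t ≤ B)
    (hunjct : ∀ n, ∀ i j : Fin K, ∀ t ∈ Icc (0 : ℝ) T, un n i 0 t = un n j 0 t)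
    {u : Fin K → ℝ → ℝ → ℝ}
    (hujct : ∀ i j : Fin K, ∀ t ∈ Icc (0 : ℝ) T, u i 0 t = u j 0 t)
    (hconv : ∀ i, TendstoLocallyUniformlyOn (fun n (q : ℝ × ℝ) => un n i q.1 q.2)
      (fun q : ℝ × ℝ => u i q.1 q.2) atTop (JDom T)) :
    KirchhoffSubsolution hK T B H u := by
  refine ⟨fun i => viscSubIn_of_tendsto (hHcont i) hε hε0 (fun n => huncont n i)
    (fun n => hdx n i) (fun n => hdxx n i) (fun n => hdt n i) (fun n => hpde n i) (hconv i), ?_⟩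
  intro t₀ ht₀ p a hjet
  have : Nonempty (Fin K) := ⟨⟨0, hK⟩⟩
  have hc : ∀ i, u i 0 t₀ = u ⟨0, hK⟩ 0 t₀ := fun i => hujct i _ t₀ (Ioc_subset_Icc_self ht₀)
  rcases superjet_ineq_of_tendsto hHcont hε hε0 huncont hdx hdxx hdt hpde hconv le_rfl ht₀
    (fun _ => hkirchhoff) (fun _ => hunjct) hc (p := p) (a := a) (fun i η hη => by
      simpa only [sub_zero, ← hc i] using hjet i η hη) with ⟨_, h⟩ | ⟨i, h⟩
  · exact (min_le_left _ _).trans (by linarith)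
  · exact (min_le_right _ _).trans ((Finset.inf'_le _ (Finset.mem_univ i)).trans h)

theorem ViscSubIn.neg {T : ℝ} {H : ℝ → ℝ → ℝ → ℝ} {w : ℝ → ℝ → ℝ}
    (h : ViscSubIn T (fun p x t => -H (-p) x t) fun x t => -w x t) : ViscSuperIn T H w := by
  intro φ x₀ t₀ hx₀ ht₀ ht₀T hφ hmin
  have key := h (fun q => -φ q) x₀ t₀ hx₀ ht₀ ht₀T hφ.neg (by
    filter_upwards [hmin] with q hq
    linarith)
  rw [fderiv_fun_neg] at key
  simp only [neg_apply, neg_neg] at key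
  linarith

theorem KirchhoffSubsolution.neg {K : ℕ} {hK : 0 < K} {T B : ℝ}
    {H : Fin K → ℝ → ℝ → ℝ → ℝ} {u : Fin K → ℝ → ℝ → ℝ}
    (h : KirchhoffSubsolution hK T (-B) (fun i p x t => -H i (-p) x t) fun i x t => -u i x t) :
    KirchhoffSupersolution hK T B H u := by
  refine ⟨fun i => (h.1 i).neg, fun t₀ ht₀ q b hjet => ?_⟩
  have key := h.2 t₀ ht₀ (fun i => -q i) (-b) (fun i η hη => by
    obtain ⟨δ, hδ, hδu⟩ := hjet i η hη
    refine ⟨δ, hδ, fun x t hx ht hlt => ?_⟩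
    linarith [hδu x t hx ht hlt])
  rcases min_le_iff.1 key with h₁ | h₁
  · rw [Finset.sum_neg_distrib] at h₁
    exact le_max_of_le_left (by linarith)
  · obtain ⟨i, -, hi⟩ := (Finset.inf'_le_iff _).1 h₁
    simp only [neg_neg] at hi
    refine le_max_of_le_right (le_trans ?_ (Finset.le_sup' _ (Finset.mem_univ i)))
    linarith

/-- **Stability of the Kirchhoff junction problem under vanishing viscosity
(Theorem 2.2).** Assume each `H_i` is continuous on `ℝ × (-∞,0] × [0,T]`, coercive in
`p` uniformly in `(x,t)`, uniformly continuous in `(p,x,t)` for bounded `p`, and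
Lipschitz in `t`. For a sequence `ε_n → 0⁺`, let `u_n = (u_{n,1},…,u_{n,K})` be
classical solutions (continuous on the closed branch, `C²` in `x` and `C¹` in `t` up
to the boundary, agreeing at the junction) of
`∂ₜ u_{n,i} − ε_n ∂ₓₓ u_{n,i} + H_i(∂ₓ u_{n,i}, x, t) = 0` in `(-∞,0) × (0,T]`
with the Kirchhoff condition `Σ_i ∂ₓ u_{n,i}(0,t) = B` on `(0,T]`. If `u_n → u`
locally uniformly on each branch, with `u` continuous and single-valued at the
junction, then `u` is a generalized viscosity solution of the Kirchhoff junction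
problem with constant `B`. -/
theorem vanishing_viscosity_stability
    (K : ℕ) (hK : 0 < K) (T B : ℝ) (hT : 0 < T)
    (H : Fin K → ℝ → ℝ → ℝ → ℝ)
    (hHcont : ∀ i, ContinuousOn (fun q : ℝ × ℝ × ℝ => H i q.1 q.2.1 q.2.2)
      {q : ℝ × ℝ × ℝ | q.2.1 ≤ 0 ∧ q.2.2 ∈ Set.Icc 0 T})
    (hHcoer : ∀ i, ∀ M : ℝ, ∃ R : ℝ, ∀ p x t : ℝ, x ≤ 0 → t ∈ Set.Icc 0 T →
      R ≤ |p| → M ≤ H i p x t)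
    (hHuc : ∀ i, ∀ R > (0 : ℝ), ∀ ε > (0 : ℝ), ∃ δ > (0 : ℝ),
      ∀ p₁ x₁ t₁ p₂ x₂ t₂ : ℝ, |p₁| ≤ R → |p₂| ≤ R → x₁ ≤ 0 → x₂ ≤ 0 →
        t₁ ∈ Set.Icc 0 T → t₂ ∈ Set.Icc 0 T →
        |p₁ - p₂| + |x₁ - x₂| + |t₁ - t₂| < δ →
        |H i p₁ x₁ t₁ - H i p₂ x₂ t₂| ≤ ε)
    (hHlip : ∀ i, ∃ Λ : ℝ, ∀ p x t₁ t₂ : ℝ, x ≤ 0 →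
      t₁ ∈ Set.Icc 0 T → t₂ ∈ Set.Icc 0 T →
      |H i p x t₁ - H i p x t₂| ≤ Λ * |t₁ - t₂|)
    -- the vanishing-viscosity parameters
    (ε : ℕ → ℝ) (hε : ∀ n, 0 < ε n) (hε0 : Filter.Tendsto ε Filter.atTop (nhds 0))
    -- the approximating classical solutions, with their space and time derivatives
    (un unx unxx unt : ℕ → Fin K → ℝ → ℝ → ℝ)
    -- regularity: `un` is continuous on each branch and its derivatives are
    -- continuous up to the boundary
    (huncont : ∀ n i, ContinuousOn (fun q : ℝ × ℝ => un n i q.1 q.2) (JDom T))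
    (hunxcont : ∀ n i, ContinuousOn (fun q : ℝ × ℝ => unx n i q.1 q.2) (JDom T))
    (hunxxcont : ∀ n i, ContinuousOn (fun q : ℝ × ℝ => unxx n i q.1 q.2) (JDom T))
    (huntcont : ∀ n i, ContinuousOn (fun q : ℝ × ℝ => unt n i q.1 q.2) (JDom T))
    -- `unx`, `unxx`, `unt` are the derivatives of `un`, up to the boundary
    (hdx : ∀ n i, ∀ x ≤ (0 : ℝ), ∀ t ∈ Set.Icc (0 : ℝ) T,
      HasDerivWithinAt (fun y => un n i y t) (unx n i x t) (Set.Iic 0) x)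
    (hdxx : ∀ n i, ∀ x ≤ (0 : ℝ), ∀ t ∈ Set.Icc (0 : ℝ) T,
      HasDerivWithinAt (fun y => unx n i y t) (unxx n i x t) (Set.Iic 0) x)
    (hdt : ∀ n i, ∀ x ≤ (0 : ℝ), ∀ t ∈ Set.Icc (0 : ℝ) T,
      HasDerivWithinAt (fun s => un n i x s) (unt n i x t) (Set.Icc 0 T) t)
    -- the approximating equation in the interior of each branch
    (hpde : ∀ n i, ∀ x < (0 : ℝ), ∀ t ∈ Set.Ioc (0 : ℝ) T,
      unt n i x t - ε n * unxx n i x t + H i (unx n i x t) x t = 0)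
    -- the Kirchhoff boundary condition at the junction
    (hkirchhoff : ∀ n, ∀ t ∈ Set.Ioc (0 : ℝ) T, ∑ i, unx n i 0 t = B)
    -- the approximations agree at the junction
    (hunjct : ∀ n, ∀ i j : Fin K, ∀ t ∈ Set.Icc (0 : ℝ) T, un n i 0 t = un n j 0 t)
    -- the limit function: continuous, single-valued at the junction
    (u : Fin K → ℝ → ℝ → ℝ)
    (hucont : ∀ i, ContinuousOn (fun q : ℝ × ℝ => u i q.1 q.2) (JDom T))
    (hujct : ∀ i j : Fin K, ∀ t ∈ Set.Icc (0 : ℝ) T, u i 0 t = u j 0 t)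
    -- branchwise locally uniform convergence
    (hconv : ∀ i, TendstoLocallyUniformlyOn (fun n (q : ℝ × ℝ) => un n i q.1 q.2)
      (fun q : ℝ × ℝ => u i q.1 q.2) Filter.atTop (JDom T)) :
    KirchhoffSubsolution hK T B H u ∧ KirchhoffSupersolution hK T B H u := by
  refine ⟨kirchhoffSubsolution_of_tendsto hK hHcont hε hε0 huncont hdx hdxx hdt
    (fun n i x hx t ht => (hpde n i x hx t ht).le) (fun n t ht => (hkirchhoff n t ht).le) hunjct
    hujct hconv, KirchhoffSubsolution.neg ?_⟩
  refine kirchhoffSubsolution_of_tendsto hK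
    (un := fun n i x t => -un n i x t) (unx := fun n i x t => -unx n i x t)
    (unxx := fun n i x t => -unxx n i x t) (unt := fun n i x t => -unt n i x t)
    (fun i => ?_) hε hε0 (fun n i => (huncont n i).neg)
    (fun n i x hx t ht => (hdx n i x hx t ht).neg) (fun n i x hx t ht => (hdxx n i x hx t ht).neg)
    (fun n i x hx t ht => (hdt n i x hx t ht).neg) (fun n i x hx t ht => ?_) (fun n t ht => ?_)
    (fun n i j t ht => neg_inj.2 (hunjct n i j t ht)) (fun i j t ht => neg_inj.2 (hujct i j t ht))
    (fun i => ?_)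
  · exact ((hHcont i).comp (f := fun q : ℝ × ℝ × ℝ => (-q.1, q.2.1, q.2.2)) (by fun_prop)
      fun q hq => hq).neg
  · simp only [neg_neg]
    linarith [hpde n i x hx t ht]
  · rw [Finset.sum_neg_distrib, hkirchhoff n t ht]
  · rw [Metric.tendstoLocallyUniformlyOn_iff]
    simpa only [dist_neg_neg] using Metric.tendstoLocallyUniformlyOn_iff.1 (hconv i)
end

section
/- Let K ≥ 1 be an integer, let H_1,…,H_K : ℝ → ℝ be continuous, and let p_1,…,p_K, q_1,…,q_K ∈ ℝ and a, b ∈ ℝ satisfy: (i) for every i ∈ {1,…,K}, p_i ≥ q_i and a + H_i(p_i) ≤ 0 ≤ b + H_i(q_i); (ii) for every choice of p'_1,…,p'_K with p'_i ≤ p_i for all i, min(Σ_{i=1}^K p'_i, min_{1≤i≤K}(a + H_i(p'_i))) ≤ 0; (iii) for every choice of q'_1,…,q'_K with q'_i ≥ q_i for all i, max(Σ_{i=1}^K q'_i, max_{1≤i≤K}(b + H_i(q'_i))) ≥ 0. Then a ≤ b. -/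
/-- **The general junction lemma (Lemma 3.1).**
Let `K ≥ 1`, let `H_1, …, H_K : ℝ → ℝ` be continuous, and let
`p_i, q_i, a, b` be reals such that
(i) for every `i`, `p_i ≥ q_i` and `a + H_i(p_i) ≤ 0 ≤ b + H_i(q_i)`;
(ii) for all `p'_i ≤ p_i`, `min(Σ_i p'_i, min_i (a + H_i(p'_i))) ≤ 0`;
(iii) for all `q'_i ≥ q_i`, `max(Σ_i q'_i, max_i (b + H_i(q'_i))) ≥ 0`.
Then `a ≤ b`. -/
theorem junction_lemma (K : ℕ) (hK : 0 < K) (H : Fin K → ℝ → ℝ)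
    (hH : ∀ i, Continuous (H i))
    (p q : Fin K → ℝ) (a b : ℝ)
    (hpq : ∀ i, q i ≤ p i)
    (hsub : ∀ i, a + H i (p i) ≤ 0)
    (hsuper : ∀ i, 0 ≤ b + H i (q i))
    (hii : ∀ p' : Fin K → ℝ, (∀ i, p' i ≤ p i) →
      min (∑ i, p' i)
        (Finset.univ.inf' ⟨⟨0, hK⟩, Finset.mem_univ _⟩ fun i => a + H i (p' i)) ≤ 0)
    (hiii : ∀ q' : Fin K → ℝ, (∀ i, q i ≤ q' i) →
      0 ≤ max (∑ i, q' i)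
        (Finset.univ.sup' ⟨⟨0, hK⟩, Finset.mem_univ _⟩ fun i => b + H i (q' i))) :
    a ≤ b := by
  by_contra! hab
  have hx : ∀ i, ∃ x ∈ Set.Icc (q i) (p i), H i x = -(a + b) / 2 := fun i =>
    intermediate_value_Icc' (hpq i) (hH i).continuousOn
      ⟨by linarith [hsub i], by linarith [hsuper i]⟩
  choose x hx hHx using hx
  have hx_sum : 0 ≤ ∑ i, x i := by
    rcases le_max_iff.1 (hiii x fun i => (hx i).1) with h | h
    · exact h
    · obtain ⟨i, -, hi⟩ := (Finset.le_sup'_iff _).1 h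
      linarith [hHx i]
  have hy : ∀ i, ∃ y, x i < y ∧ y ≤ p i ∧ 0 < a + H i y := by
    intro i
    have hlt : x i < p i := (hx i).2.lt_of_ne fun h => by
      have := hHx i
      rw [h] at this
      linarith [hsub i]
    have hpos : ∀ᶠ y in nhdsWithin (x i) (Set.Ioi (x i)), 0 < a + H i y :=
      ((continuous_const.add (hH i)).continuousAt.eventually
        (lt_mem_nhds (show 0 < a + H i (x i) by linarith [hHx i]))).filter_mono nhdsWithin_le_nhds
    obtain ⟨y, hy, hmem⟩ := (hpos.and (Ioc_mem_nhdsGT hlt)).exists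
    exact ⟨y, hmem.1, hmem.2, hy⟩
  choose y hxy hyp hHy using hy
  have hy_sum : ∑ i, x i < ∑ i, y i :=
    Finset.sum_lt_sum_of_nonempty ⟨⟨0, hK⟩, Finset.mem_univ _⟩ fun i _ => hxy i
  refine (hii y hyp).not_gt (lt_min (hx_sum.trans_lt hy_sum) ?_)
  exact (Finset.lt_inf'_iff _).2 fun i _ => hHy i
end

section
/- Let C ≥ 0, L ≥ 0, c < 0, T > 0 and t_0 ∈ (0,T). Let z : [c,0] × [0,T] → ℝ be L-Lipschitz continuous, and suppose that for every x ∈ [c,0] the function t ↦ z(x,t) + C t² is convex on [0,T] (z is semiconvex in t, uniformly in x). For (x,t) ∈ [c,0] × (0,T), let ∂z(x,t) denote the subdifferential of z with respect to t at (x,t), i.e. the set of p ∈ ℝ such that liminf_{s→t} (z(x,s) − z(x,t) − p(s−t))/|s−t| ≥ 0. Suppose the partial derivative ā := ∂_t z(0,t_0) exists. Then lim_{(x,t)→(0,t_0)} sup_{p ∈ ∂z(x,t)} |p − ā| = 0; that is, for every ε > 0 there exists δ > 0 such that whenever |x| + |t − t_0| < δ, t ∈ (0,T), and p ∈ ∂z(x,t),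 one has |p − ā| ≤ ε. -/
/-- `p` belongs to the subdifferential with respect to `t` of `z` at `(x, t)`,
relative to the time interval `[0, T]`: `z(x,s) ≥ z(x,t) + p(s−t) + o(|s−t|)` as `s → t`. -/
def TimeSubdiff (T : ℝ) (z : ℝ → ℝ → ℝ) (x t p : ℝ) : Prop :=
  ∀ ε > (0 : ℝ), ∃ δ > (0 : ℝ), ∀ s ∈ Set.Icc (0 : ℝ) T, |s - t| < δ →
    z x s - z x t - p * (s - t) ≥ -ε * |s - t|

/-- For a function semiconvex in time, the local subdifferential inequality holds globally
up to the quadratic semiconvexity term. -/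
theorem TimeSubdiff.global_lower_bound {C T x t p : ℝ} {z : ℝ → ℝ → ℝ} (hC : 0 ≤ C)
    (ht : t ∈ Set.Icc 0 T)
    (hconv : ConvexOn ℝ (Set.Icc 0 T) (fun t => z x t + C * t ^ 2))
    (hp : TimeSubdiff T z x t p) {h : ℝ} (hs : t + h ∈ Set.Icc 0 T) :
    p * h ≤ z x (t + h) - z x t + C * h ^ 2 := by
  apply le_of_forall_pos_le_add
  intro η hη
  obtain ⟨δ, hδ, H⟩ := hp (η / (|h| + 1)) (by positivity)
  obtain ⟨l, hl0, hl⟩ : ∃ l : ℝ, 0 < l ∧ l < min 1 (δ / (|h| + 1)) :=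
    exists_between (by positivity)
  have hl1 : l < 1 := hl.trans_le (min_le_left _ _)
  have hlδ : l * (|h| + 1) < δ := (lt_div_iff₀ (by positivity)).1 (hl.trans_le (min_le_right _ _))
  have hcomb : (1 - l) * t + l * (t + h) = t + l * h := by ring
  have hmem : t + l * h ∈ Set.Icc 0 T := by
    have := hconv.1 ht hs (sub_nonneg.2 hl1.le) hl0.le (by ring)
    simpa only [smul_eq_mul, hcomb] using this
  have hcx := hconv.2 ht hs (sub_nonneg.2 hl1.le) hl0.le (by ring)
  simp only [smul_eq_mul, hcomb] at hcx
  have hsub := H (t + l * h) hmem (by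
    rw [add_sub_cancel_left, abs_mul, abs_of_pos hl0]; nlinarith [abs_nonneg h])
  rw [add_sub_cancel_left, abs_mul, abs_of_pos hl0] at hsub
  have hη' : η / (|h| + 1) * |h| ≤ η := by
    rw [div_mul_eq_mul_div, div_le_iff₀ (by positivity)]
    nlinarith [abs_nonneg h]
  have hlη := mul_le_mul_of_nonneg_left hη' hl0.le
  have hCl : 0 ≤ C * l ^ 2 * h ^ 2 := by positivity
  refine le_of_mul_le_mul_left ?_ hl0
  nlinarith

/-- A differentiable function is within `ε * r` of its linearization at the points `t ± r`,
for some arbitrarily small `r > 0`. -/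
theorem HasDerivAt.exists_small_increment {f : ℝ → ℝ} {a t : ℝ} (hf : HasDerivAt f a t)
    {ε ρ : ℝ} (hε : 0 < ε) (hρ : 0 < ρ) :
    ∃ r > 0, r < ρ ∧ ∀ h : ℝ, |h| = r → |f (t + h) - f t - a * h| ≤ ε * r := by
  have := (hasDerivAt_iff_isLittleO.1 hf).def hε
  obtain ⟨d, hd, H⟩ := Metric.eventually_nhds_iff.1 this
  obtain ⟨r, hr, hr'⟩ := exists_between (lt_min hd hρ)
  refine ⟨r, hr, hr'.trans_le (min_le_right _ _), fun h hh => ?_⟩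
  have hb := H (y := t + h) (by
    rw [Real.dist_eq, add_sub_cancel_left, hh]; exact hr'.trans_le (min_le_left _ _))
  simpa only [add_sub_cancel_left, smul_eq_mul, Real.norm_eq_abs, hh, mul_comm h a] using hb

/-- **Lemma 4.1 (`C¹`-type property of the time subdifferential of semiconvex functions).**
Let `z : [c,0] × [0,T] → ℝ` be `L`-Lipschitz and semiconvex in `t` (uniformly in `x`)
with constant `C`, and suppose the partial derivative `ā = ∂ₜ z(0, t₀)` exists at some
`t₀ ∈ (0,T)`. Then `sup_{p ∈ ∂z(x,t)} |p − ā| → 0` as `(x,t) → (0,t₀)`. -/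
theorem time_subdiff_continuity
    (C L c T t₀ : ℝ) (hC : 0 ≤ C) (hL : 0 ≤ L) (hc : c < 0) (hT : 0 < T)
    (ht₀ : t₀ ∈ Set.Ioo 0 T)
    (z : ℝ → ℝ → ℝ)
    (hLip : ∀ x₁ t₁ x₂ t₂ : ℝ, x₁ ∈ Set.Icc c 0 → x₂ ∈ Set.Icc c 0 →
      t₁ ∈ Set.Icc 0 T → t₂ ∈ Set.Icc 0 T →
      |z x₁ t₁ - z x₂ t₂| ≤ L * (|x₁ - x₂| + |t₁ - t₂|))
    (hconv : ∀ x ∈ Set.Icc c 0, ConvexOn ℝ (Set.Icc 0 T) (fun t => z x t + C * t ^ 2))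
    (abar : ℝ) (hder : HasDerivAt (fun s => z 0 s) abar t₀) :
    ∀ ε > (0 : ℝ), ∃ δ > (0 : ℝ), ∀ x t p : ℝ, x ∈ Set.Icc c 0 → t ∈ Set.Ioo 0 T →
      |x| + |t - t₀| < δ → TimeSubdiff T z x t p → |p - abar| ≤ ε := by
  intro ε hε
  obtain ⟨ht0, htT⟩ := ht₀
  obtain ⟨r, hr, hrρ, hlin⟩ := hder.exists_small_increment (ε := ε / 4)
    (ρ := min (ε / (4 * (C + 1))) (min (t₀ / 2) ((T - t₀) / 2))) (by positivity)
    (lt_min (by positivity) (lt_min (by linarith) (by linarith)))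
  simp only [lt_min_iff] at hrρ
  obtain ⟨hrC, hr0, hrT⟩ := hrρ
  rw [lt_div_iff₀ (by positivity)] at hrC
  refine ⟨min r (ε * r / (8 * (L + 1))), by positivity, fun x t p hx ht hxt hp => ?_⟩
  obtain ⟨hδr, hδL⟩ := lt_min_iff.1 hxt
  rw [lt_div_iff₀ (by positivity)] at hδL
  have hx0 := abs_nonneg x
  have htt := abs_lt.1 (show |t - t₀| < r by linarith)
  have htm : t ∈ Set.Icc 0 T := ⟨ht.1.le, ht.2.le⟩
  have h0 : (0 : ℝ) ∈ Set.Icc c 0 := ⟨hc.le, le_rfl⟩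
  have hLd : 8 * (L * (|x| + |t - t₀|)) ≤ ε * r := by
    nlinarith [abs_nonneg (t - t₀)]
  have key : ∀ h : ℝ, |h| = r → (p - abar) * h ≤ ε * r := by
    intro h hh
    have hhr := abs_le.1 hh.le
    have hs : t + h ∈ Set.Icc 0 T := ⟨by linarith, by linarith⟩
    have hs₀ : t₀ + h ∈ Set.Icc 0 T := ⟨by linarith, by linarith⟩
    have hglob := hp.global_lower_bound hC htm (hconv x hx) hs
    have h1 := hLip x (t + h) 0 (t₀ + h) hx h0 hs hs₀
    have h2 := hLip x t 0 t₀ hx h0 htm ⟨ht0.le, htT.le⟩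
    rw [sub_zero, add_sub_add_right_eq_sub] at h1
    rw [sub_zero] at h2
    have h3 := (abs_le.1 (hlin h hh)).2
    have hsq : h ^ 2 = r ^ 2 := by rw [← hh, sq_abs]
    rw [hsq] at hglob
    have hCr : C * r ^ 2 ≤ ε / 4 * r := by nlinarith
    linarith [(abs_le.1 h1).2, (abs_le.1 h2).1, mul_pos hε hr]
  have hpos := key r (abs_of_pos hr)
  have hneg := key (-r) (by rw [abs_neg, abs_of_pos hr])
  exact abs_le.2 ⟨by nlinarith, by nlinarith⟩
end

section
/- A semiconvex function with a nonempty superdifferential is differentiable there: let C ≥ 0 and f : ℝ → ℝ be such that t ↦ f(t) + C t² is convex on ℝ. If for some t_0 ∈ ℝ there exists p ∈ ℝ with f(s) ≤ f(t_0) + p(s − t_0) + o(|s − t_0|) as s → t_0 (i.e. limsup_{s→t_0} (f(s) − f(t_0) − p(s − t_0))/|s − t_0| ≤ 0), then f is differentiable at t_0 and f'(t_0) = p. -/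
/-- **Semiconvex functions are differentiable wherever the superdifferential is nonempty.**
Let `C ≥ 0` and `f : ℝ → ℝ` be such that `t ↦ f(t) + C t²` is convex. If at some `t₀`
there is `p` with `f(s) ≤ f(t₀) + p (s − t₀) + o(|s − t₀|)` as `s → t₀`, then `f` is
differentiable at `t₀` with `f'(t₀) = p`. -/
theorem semiconvex_superdiff_hasDerivAt
    (C : ℝ) (hC : 0 ≤ C) (f : ℝ → ℝ)
    (hconv : ConvexOn ℝ Set.univ (fun t => f t + C * t ^ 2))
    (t₀ p : ℝ)
    (hp : ∀ ε > (0 : ℝ), ∃ δ > (0 : ℝ), ∀ s : ℝ, |s - t₀| < δ →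
      f s ≤ f t₀ + p * (s - t₀) + ε * |s - t₀|) :
    HasDerivAt f p t₀ := by
  rw [hasDerivAt_iff_isLittleO, Asymptotics.isLittleO_iff]
  intro c hc
  obtain ⟨δ, hδ, H⟩ := hp (c / 2) (by positivity)
  have hη : 0 < min δ (c / (4 * (C + 1))) := by positivity
  filter_upwards [Metric.ball_mem_nhds t₀ hη] with s hs
  rw [Metric.mem_ball, Real.dist_eq, lt_min_iff, lt_div_iff₀ (by positivity)] at hs
  obtain ⟨hs₁, hs₂⟩ := hs
  have upper := H s hs₁
  -- The lower bound comes from midpoint convexity and the upper bound at the reflected point.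
  have refl_sub : t₀ - (s - t₀) - t₀ = -(s - t₀) := by ring
  have reflected := H (t₀ - (s - t₀)) (by rwa [refl_sub, abs_neg])
  rw [refl_sub, abs_neg] at reflected
  have midpoint := hconv.2 (Set.mem_univ s) (Set.mem_univ (t₀ - (s - t₀)))
    (by norm_num : (0 : ℝ) ≤ 1 / 2) (by norm_num : (0 : ℝ) ≤ 1 / 2) (by norm_num)
  have midpoint_eq : (1 / 2 : ℝ) * s + 1 / 2 * (t₀ - (s - t₀)) = t₀ := by ring
  simp only [smul_eq_mul, midpoint_eq] at midpoint
  have habs := abs_nonneg (s - t₀)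
  have quadratic : 2 * C * (s - t₀) ^ 2 ≤ c / 2 * |s - t₀| := by
    rw [← sq_abs]
    nlinarith
  have error_nonneg : 0 ≤ c / 2 * |s - t₀| := by positivity
  rw [Real.norm_eq_abs, Real.norm_eq_abs, smul_eq_mul, abs_le]
  constructor <;> linarith
end

section
/- Blow-up property of Lipschitz viscosity subsolutions at the boundary: let H : ℝ → ℝ be continuous, a ∈ ℝ, and let U : (-∞,0] → ℝ be Lipschitz continuous and a viscosity subsolution of a + H(U') ≤ 0 in (-∞,0), i.e. whenever φ : ℝ → ℝ is differentiable and U − φ attains a local maximum at a point x_0 ∈ (-∞,0), then a + H(φ'(x_0)) ≤ 0. Set p̲ := liminf_{x→0⁻} U(x)/x − U(0)/x, more precisely p̲ := liminf_{x→0⁻} (U(x) − U(0))/x and p̄ := limsup_{x→0⁻} (U(x) − U(0))/x. Then a + H(p) ≤ 0 for every p ∈ [p̲, p̄]. -/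
open Filter

/-- If `U - φ` is larger at `z` than at both ends of `[y₁, y₂]`, then `φ` touches `U` from above
at an interior point, where the subsolution inequality holds. -/
theorem exists_subsolution_ineq_of_lt
    {H : ℝ → ℝ} {a : ℝ} {U : ℝ → ℝ} (hU : ContinuousOn U (Set.Iic 0))
    (hsub : ∀ (φ : ℝ → ℝ) (x₀ : ℝ), x₀ < 0 → Differentiable ℝ φ →
      (∀ᶠ x in nhdsWithin x₀ (Set.Iio (0 : ℝ)), U x - φ x ≤ U x₀ - φ x₀) →
      a + H (deriv φ x₀) ≤ 0)
    {φ : ℝ → ℝ} (hφ : Differentiable ℝ φ) {y₁ z y₂ : ℝ} (hy₁ : y₁ < z) (hy₂ : z < y₂)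
    (h0 : y₂ ≤ 0) (h₁ : U y₁ - φ y₁ < U z - φ z) (h₂ : U y₂ - φ y₂ < U z - φ z) :
    ∃ x ∈ Set.Ioo y₁ y₂, a + H (deriv φ x) ≤ 0 := by
  have hcont : ContinuousOn (fun x => U x - φ x) (Set.Icc y₁ y₂) :=
    (hU.mono fun x hx => hx.2.trans h0).sub hφ.continuous.continuousOn
  obtain ⟨x, hx, hmax⟩ := isCompact_Icc.exists_isMaxOn ⟨z, hy₁.le, hy₂.le⟩ hcont
  have hz : U z - φ z ≤ U x - φ x := hmax ⟨hy₁.le, hy₂.le⟩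
  have hx₁ : y₁ < x := lt_of_le_of_ne hx.1 (by rintro rfl; linarith)
  have hx₂ : x < y₂ := lt_of_le_of_ne hx.2 (by rintro rfl; linarith)
  refine ⟨x, ⟨hx₁, hx₂⟩, hsub φ x (hx₂.trans_le h0) hφ (mem_nhdsWithin_of_mem_nhds ?_)⟩
  filter_upwards [Icc_mem_nhds hx₁ hx₂] with w hw using hmax hw

/-- A slope `p` which the difference quotients at `0` cross infinitely often satisfies the
subsolution inequality. -/
theorem subsolution_ineq_of_frequently
    {H : ℝ → ℝ} {a : ℝ} {U : ℝ → ℝ} (hU : ContinuousOn U (Set.Iic 0))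
    (hsub : ∀ (φ : ℝ → ℝ) (x₀ : ℝ), x₀ < 0 → Differentiable ℝ φ →
      (∀ᶠ x in nhdsWithin x₀ (Set.Iio (0 : ℝ)), U x - φ x ≤ U x₀ - φ x₀) →
      a + H (deriv φ x₀) ≤ 0)
    {p : ℝ} (hlt : ∃ᶠ x in nhdsWithin 0 (Set.Iio (0 : ℝ)), (U x - U 0) / x < p)
    (hgt : ∃ᶠ x in nhdsWithin 0 (Set.Iio (0 : ℝ)), p < (U x - U 0) / x) :
    a + H p ≤ 0 := by
  obtain ⟨y₁, hy₁, hy₁0⟩ := (hgt.and_eventually self_mem_nhdsWithin).exists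
  obtain ⟨z, hz, hz₁, hz0⟩ := (hlt.and_eventually (Ioo_mem_nhdsLT hy₁0)).exists
  obtain ⟨y₂, hy₂, hy₂z, hy₂0⟩ := (hgt.and_eventually (Ioo_mem_nhdsLT hz0)).exists
  rw [lt_div_iff_of_neg hy₁0] at hy₁
  rw [div_lt_iff_of_neg hz0] at hz
  rw [lt_div_iff_of_neg hy₂0] at hy₂
  obtain ⟨x, -, hx⟩ := exists_subsolution_ineq_of_lt hU hsub (φ := fun x => p * x)
    (differentiable_id.const_mul p) hz₁ hy₂z hy₂0.le (by linarith) (by linarith)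
  have hd : deriv (fun x : ℝ => p * x) x = p := by
    simp
  rwa [hd] at hx

/-- If the left derivative of `U` at `0` exists, it satisfies the subsolution inequality. -/
theorem subsolution_ineq_of_tendsto
    {H : ℝ → ℝ} (hH : Continuous H) {a : ℝ} {U : ℝ → ℝ} (hU : ContinuousOn U (Set.Iic 0))
    (hsub : ∀ (φ : ℝ → ℝ) (x₀ : ℝ), x₀ < 0 → Differentiable ℝ φ →
      (∀ᶠ x in nhdsWithin x₀ (Set.Iio (0 : ℝ)), U x - φ x ≤ U x₀ - φ x₀) →
      a + H (deriv φ x₀) ≤ 0)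
    {p : ℝ} (hp : Tendsto (fun x => (U x - U 0) / x) (nhdsWithin 0 (Set.Iio (0 : ℝ))) (nhds p)) :
    a + H p ≤ 0 := by
  have hclosed : IsClosed {q | a + H q ≤ 0} :=
    isClosed_le (continuous_const.add hH) continuous_const
  refine hclosed.closure_subset (Metric.mem_closure_iff.2 fun δ hδ => ?_)
  obtain ⟨ε, hε, rfl⟩ : ∃ ε > 0, δ = 10 * ε := ⟨δ / 10, by positivity, by ring⟩
  have hev := hp.eventually (Metric.ball_mem_nhds p hε)
  obtain ⟨l, hl, hsubset⟩ := mem_nhdsLT_iff_exists_Ioo_subset.1 hev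
  have hl : l < 0 := hl
  have hbd : ∀ x, l < x → x < 0 → |U x - U 0 - p * x| < ε * -x := by
    intro x hx hx0
    have h : |(U x - U 0) / x - p| < ε := hsubset ⟨hx, hx0⟩
    have heq : U x - U 0 - p * x = ((U x - U 0) / x - p) * x := by
      field_simp [hx0.ne]
    rw [heq, abs_mul, abs_of_neg hx0]
    exact mul_lt_mul_of_pos_right h (neg_pos.2 hx0)
  obtain ⟨r, hr, hrl⟩ : ∃ r > 0, l < -(2 * r) := ⟨-l / 4, by linarith, by linarith⟩
  have hK : 5 * ε / r * r ^ 2 = 5 * ε * r := by field_simp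
  have hder (x : ℝ) :
      HasDerivAt (fun x => p * x + 5 * ε / r * (x + r) ^ 2) (p + 10 * ε / r * (x + r)) x := by
    refine (((hasDerivAt_id' x).const_mul p).add
      ((((hasDerivAt_id' x).add_const r).pow 2).const_mul (5 * ε / r))).congr_deriv ?_
    push_cast
    ring
  have hmid := abs_lt.1 (hbd (-r) (by linarith) (by linarith))
  have hleft := abs_lt.1 (hbd (-(2 * r)) hrl (by linarith))
  have hεr : 0 < ε * r := by positivity
  obtain ⟨x, hx, hxH⟩ := exists_subsolution_ineq_of_lt hU hsub
    (φ := fun x => p * x + 5 * ε / r * (x + r) ^ 2) (fun x => (hder x).differentiableAt)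
    (y₁ := -(2 * r)) (z := -r) (y₂ := 0) (by linarith) (by linarith) le_rfl
    (by ring_nf at hmid hleft hK ⊢; linarith [hmid.1, hleft.2])
    (by ring_nf at hmid hK ⊢; linarith [hmid.1])
  rw [(hder x).deriv] at hxH
  refine ⟨_, hxH, ?_⟩
  have hxr : |x + r| < r := abs_lt.2 ⟨by linarith [hx.1], by linarith [hx.2]⟩
  rw [Real.dist_eq, sub_add_cancel_left, abs_neg, abs_mul, abs_of_pos (by positivity)]
  calc 10 * ε / r * |x + r| < 10 * ε / r * r := by gcongr
    _ = 10 * ε := by field_simp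

/-- **Blow-up property of Lipschitz viscosity subsolutions at the boundary.**
Let `H : ℝ → ℝ` be continuous, `a ∈ ℝ`, and let `U : (-∞,0] → ℝ` be Lipschitz and a
viscosity subsolution of `a + H(U') ≤ 0` in `(-∞,0)`: whenever `φ` is differentiable
and `U − φ` attains a local maximum (relative to `(-∞,0)`) at `x₀ < 0`, then
`a + H(φ'(x₀)) ≤ 0`. With `p̲ = liminf_{x→0⁻} (U(x) − U(0))/x` and
`p̄ = limsup_{x→0⁻} (U(x) − U(0))/x`, one has `a + H(p) ≤ 0` for every `p ∈ [p̲, p̄]`. -/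
theorem subsolution_blowup_interval
    (H : ℝ → ℝ) (hH : Continuous H) (a : ℝ)
    (L : ℝ) (hL : 0 ≤ L) (U : ℝ → ℝ)
    (hLip : ∀ x ∈ Set.Iic (0 : ℝ), ∀ y ∈ Set.Iic (0 : ℝ), |U x - U y| ≤ L * |x - y|)
    (hsub : ∀ (φ : ℝ → ℝ) (x₀ : ℝ), x₀ < 0 → Differentiable ℝ φ →
      (∀ᶠ x in nhdsWithin x₀ (Set.Iio (0 : ℝ)), U x - φ x ≤ U x₀ - φ x₀) →
      a + H (deriv φ x₀) ≤ 0) :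
    ∀ p ∈ Set.Icc
        (liminf (fun x => (U x - U 0) / x) (nhdsWithin 0 (Set.Iio (0 : ℝ))))
        (limsup (fun x => (U x - U 0) / x) (nhdsWithin 0 (Set.Iio (0 : ℝ)))),
      a + H p ≤ 0 := by
  have hU : ContinuousOn U (Set.Iic 0) :=
    (LipschitzOnWith.of_dist_le_mul (K := ⟨L, hL⟩) fun x hx y hy => hLip x hx y hy).continuousOn
  have hbd : ∀ᶠ x in nhdsWithin 0 (Set.Iio (0 : ℝ)), |(U x - U 0) / x| ≤ L := by
    filter_upwards [self_mem_nhdsWithin] with x hx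
    rw [abs_div, div_le_iff₀ (abs_pos.2 (ne_of_lt hx))]
    simpa using hLip x (Set.Iio_subset_Iic_self hx) 0 Set.self_mem_Iic
  have hle : IsBoundedUnder (· ≤ ·) (nhdsWithin 0 (Set.Iio (0 : ℝ)))
      (fun x => (U x - U 0) / x) := ⟨L, hbd.mono fun x hx => (abs_le.1 hx).2⟩
  have hge : IsBoundedUnder (· ≥ ·) (nhdsWithin 0 (Set.Iio (0 : ℝ)))
      (fun x => (U x - U 0) / x) := ⟨-L, hbd.mono fun x hx => (abs_le.1 hx).1⟩
  intro p hp
  rcases (hp.1.trans hp.2).eq_or_lt with heq | hlt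
  · refine subsolution_ineq_of_tendsto hH hU hsub ?_
    exact tendsto_of_liminf_eq_limsup (le_antisymm hp.1 (hp.2.trans heq.ge))
      (le_antisymm (heq.ge.trans hp.1) hp.2) hle hge
  · rw [← closure_Ioo hlt.ne] at hp
    have hclosed : IsClosed {q | a + H q ≤ 0} :=
      isClosed_le (continuous_const.add hH) continuous_const
    refine closure_minimal (fun q hq => ?_) hclosed hp
    exact subsolution_ineq_of_frequently hU hsub
      (frequently_lt_of_liminf_lt hle.isCoboundedUnder_ge hq.1)
      (frequently_lt_of_lt_limsup hge.isCoboundedUnder_le hq.2)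
end

section
/- Blow-up convergence in time for semiconvex functions: let C ≥ 0, L ≥ 0, T > 0 and t_0 ∈ (0,T). Let w : ℝ × [0,T] → ℝ be L-Lipschitz continuous, with t ↦ w(x,t) + C t² convex on [0,T] for every x ∈ ℝ, and suppose the partial derivative a := ∂_t w(0,t_0) exists. Then (w(εx, t_0 + εs) − w(εx, t_0))/ε → a·s as ε → 0⁺, locally uniformly in (x,s) ∈ ℝ × ℝ (with the rescaled time t_0 + εs restricted to [0,T]). -/
/-- A convex function on `[-δ, δ]` vanishing at `0` and at most `M` at the endpoints
satisfies `|g h| ≤ |h| / δ * M`. -/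
theorem ConvexOn.abs_le_of_endpoints_le {g : ℝ → ℝ} {δ M : ℝ} (hδ : 0 < δ)
    (hg : ConvexOn ℝ (Set.Icc (-δ) δ) g) (h0 : g 0 = 0) (hr : g δ ≤ M) (hl : g (-δ) ≤ M)
    {h : ℝ} (hh : |h| ≤ δ) : |g h| ≤ |h| / δ * M := by
  have upper : ∀ k : ℝ, |k| ≤ δ → g k ≤ |k| / δ * M := by
    intro k hk
    have hp : 0 ≤ |k| / δ := by positivity
    have hq : 0 ≤ 1 - |k| / δ := sub_nonneg.2 ((div_le_one hδ).2 hk)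
    have key : ∀ e ∈ Set.Icc (-δ) δ, g e ≤ M → |k| / δ * e = k → g k ≤ |k| / δ * M := by
      intro e he heM hek
      have := hg.2 he (show (0 : ℝ) ∈ Set.Icc (-δ) δ from ⟨by linarith, hδ.le⟩) hp hq (by ring)
      simp only [smul_eq_mul, mul_zero, add_zero, h0, hek] at this
      exact this.trans (mul_le_mul_of_nonneg_left heM hp)
    rcases le_total 0 k with hk0 | hk0
    · exact key δ ⟨by linarith, le_rfl⟩ hr (by rw [abs_of_nonneg hk0]; field_simp)
    · exact key (-δ) ⟨le_rfl, by linarith⟩ hl (by rw [abs_of_nonpos hk0]; field_simp)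
  have h₁ := upper h hh
  have h₂ := upper (-h) (by rwa [abs_neg])
  rw [abs_neg] at h₂
  obtain ⟨ha, hb⟩ := abs_le.1 hh
  have hmid := hg.2 (show h ∈ Set.Icc (-δ) δ from ⟨ha, hb⟩)
    (show -h ∈ Set.Icc (-δ) δ from ⟨by linarith, by linarith⟩)
    (show (0 : ℝ) ≤ 1 / 2 by norm_num) (show (0 : ℝ) ≤ 1 / 2 by norm_num) (by norm_num)
  simp only [smul_eq_mul] at hmid
  rw [show (1 / 2 : ℝ) * h + 1 / 2 * -h = 0 by ring, h0] at hmid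
  exact abs_le.2 ⟨by linarith, h₁⟩

/-- **Blow-up convergence in time for semiconvex functions.**
Let `w : ℝ × [0,T] → ℝ` be `L`-Lipschitz, semiconvex in `t` with constant `C`
uniformly in `x`, and suppose the partial derivative `a = ∂ₜ w(0, t₀)` exists at some
`t₀ ∈ (0,T)`. Then `(w(εx, t₀ + εs) − w(εx, t₀))/ε → a s` as `ε → 0⁺`, locally
uniformly in `(x, s)` (with the rescaled time constrained to `[0,T]`). -/
theorem semiconvex_time_blowup
    (C L T t₀ : ℝ) (hC : 0 ≤ C) (hL : 0 ≤ L) (hT : 0 < T) (ht₀ : t₀ ∈ Set.Ioo 0 T)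
    (w : ℝ → ℝ → ℝ)
    (hLip : ∀ x₁ t₁ x₂ t₂ : ℝ, t₁ ∈ Set.Icc 0 T → t₂ ∈ Set.Icc 0 T →
      |w x₁ t₁ - w x₂ t₂| ≤ L * (|x₁ - x₂| + |t₁ - t₂|))
    (hconv : ∀ x : ℝ, ConvexOn ℝ (Set.Icc 0 T) (fun t => w x t + C * t ^ 2))
    (a : ℝ) (hder : HasDerivAt (fun s => w 0 s) a t₀) :
    ∀ R > (0 : ℝ), ∀ η > (0 : ℝ), ∃ ε₀ > (0 : ℝ), ∀ ε : ℝ, 0 < ε → ε < ε₀ →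
      ∀ x s : ℝ, |x| ≤ R → |s| ≤ R → t₀ + ε * s ∈ Set.Icc 0 T →
        |(w (ε * x) (t₀ + ε * s) - w (ε * x) t₀) / ε - a * s| ≤ η := by
  intro R hR η hη
  obtain ⟨ht0, htT⟩ := ht₀
  have hκ : 0 < η / (4 * R) := by positivity
  obtain ⟨ρ, hρ, hρw⟩ := Metric.eventually_nhds_iff.1
    ((hasDerivAt_iff_isLittleO.1 hder).def hκ)
  obtain ⟨δ, hδ, hδm⟩ : ∃ δ : ℝ, 0 < δ ∧
      δ < min (min ρ (η / (8 * R * (C + 1)))) (min t₀ (T - t₀)) := by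
    refine exists_between (lt_min (lt_min hρ (by positivity)) (lt_min ht0 (by linarith)))
  simp only [lt_min_iff] at hδm
  obtain ⟨⟨hδρ, hδη⟩, hδt, hδT⟩ := hδm
  rw [lt_div_iff₀ (by positivity)] at hδη
  refine ⟨min (δ / R) (δ * η / (8 * (L + 1) * R ^ 2)), by positivity, ?_⟩
  intro ε hε hεm x s hx hs _
  obtain ⟨hε₁, hε₂⟩ := lt_min_iff.1 hεm
  rw [lt_div_iff₀ hR] at hε₁
  rw [lt_div_iff₀ (by positivity)] at hε₂
  set y := ε * x
  set h := ε * s with h_def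
  have hy : |y| ≤ ε * R := by
    rw [abs_mul, abs_of_pos hε]; gcongr
  have hh : |h| ≤ ε * R := by
    rw [abs_mul, abs_of_pos hε]; gcongr
  have hhδ : |h| ≤ δ := by linarith
  set g : ℝ → ℝ := fun k => w y (t₀ + k) - w y t₀ + C * k ^ 2 - a * k with hg
  have hconvg : ConvexOn ℝ (Set.Icc (-δ) δ) g := by
    refine ⟨convex_Icc _ _, ?_⟩
    intro k₁ hk₁ k₂ hk₂ p q hp hq hpq
    have hc := (hconv y).2
      (show t₀ + k₁ ∈ Set.Icc 0 T from ⟨by linarith [hk₁.1], by linarith [hk₁.2]⟩)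
      (show t₀ + k₂ ∈ Set.Icc 0 T from ⟨by linarith [hk₂.1], by linarith [hk₂.2]⟩) hp hq hpq
    obtain rfl : q = 1 - p := by linarith
    simp only [smul_eq_mul, hg] at hc ⊢
    rw [show p * (t₀ + k₁) + (1 - p) * (t₀ + k₂) = t₀ + (p * k₁ + (1 - p) * k₂) by ring] at hc
    linarith
  have hend : ∀ k : ℝ, |k| = δ → g k ≤ η / (4 * R) * δ + 2 * L * (ε * R) + C * δ ^ 2 := by
    intro k hk
    obtain ⟨hk₁, hk₂⟩ := abs_le.1 hk.le
    have hd := hρw (show dist (t₀ + k) t₀ < ρ by simpa [hk] using hδρ)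
    simp only [add_sub_cancel_left, Real.norm_eq_abs, smul_eq_mul, hk] at hd
    have e₁ := hLip y (t₀ + k) 0 (t₀ + k) ⟨by linarith, by linarith⟩ ⟨by linarith, by linarith⟩
    have e₂ := hLip y t₀ 0 t₀ ⟨by linarith, by linarith⟩ ⟨by linarith, by linarith⟩
    simp only [sub_self, abs_zero, add_zero, sub_zero] at e₁ e₂
    have e₃ : L * |y| ≤ L * (ε * R) := by gcongr
    have e₄ : k ^ 2 = δ ^ 2 := by rw [← hk, sq_abs]
    simp only [hg, e₄]
    linarith [(abs_le.1 hd).2, (abs_le.1 e₁).2, (abs_le.1 e₂).1]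
  have hgh := hconvg.abs_le_of_endpoints_le hδ (by simp [hg])
    (hend δ (abs_of_pos hδ)) (hend (-δ) (by rw [abs_neg, abs_of_pos hδ])) hhδ
  have hsq : C * h ^ 2 ≤ |h| * (C * δ) := by
    rw [← sq_abs]
    nlinarith [mul_le_mul_of_nonneg_left hhδ (mul_nonneg hC (abs_nonneg h))]
  have hsq0 : 0 ≤ C * h ^ 2 := by positivity
  have hsum : η / (4 * R) + 2 * L * (ε * R) / δ + 2 * C * δ ≤ η / R := by
    have b₁ : 2 * L * (ε * R) / δ ≤ η / (4 * R) := by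
      rw [div_le_div_iff₀ hδ (by positivity)]
      nlinarith [show 0 < ε * R ^ 2 by positivity]
    have b₂ : 2 * C * δ ≤ η / (4 * R) := by
      rw [le_div_iff₀ (by positivity)]
      nlinarith [show 0 < R * δ by positivity]
    have b₃ : η / R = 4 * (η / (4 * R)) := by field_simp
    linarith
  have hmain : |w y (t₀ + h) - w y t₀ - a * h| ≤ ε * η := by
    calc |w y (t₀ + h) - w y t₀ - a * h| = |g h - C * h ^ 2| := by
          congr 1; simp only [hg]; ring
      _ ≤ |g h| + C * h ^ 2 := (abs_sub _ _).trans_eq (by rw [abs_of_nonneg hsq0])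
      _ ≤ |h| / δ * (η / (4 * R) * δ + 2 * L * (ε * R) + C * δ ^ 2) + |h| * (C * δ) := by
          gcongr
      _ = |h| * (η / (4 * R) + 2 * L * (ε * R) / δ + 2 * C * δ) := by
          field_simp; ring
      _ ≤ (ε * R) * (η / R) := by gcongr
      _ = ε * η := by field_simp
  rw [show (w y (t₀ + h) - w y t₀) / ε - a * s = (w y (t₀ + h) - w y t₀ - a * h) / ε by
    rw [h_def]; field_simp, abs_div, abs_of_pos hε, div_le_iff₀ hε]
  linarith
end

section
/- Flux-limited solutions are generalized Kirchhoff solutions: fix an integer K ≥ 1 and T > 0. For each i ∈ {1,…,K}, let H̃_i : ℝ → ℝ be convex, continuous, coercive (H̃_i(p) → +∞ as |p| → ∞), with a unique global minimum point p_i^0. Define H̃_i^-(p) = H̃_i(p) for p ≤ p_i^0 and H̃_i^-(p) = H̃_i(p_i^0) for p ≥ p_i^0. Fix A ≥ A_0 := max_{1≤i≤K} min_ℝ H̃_i and for each i let p_i^A be the unique point in [p_i^0, ∞) with H̃_i(p_i^A) = A. Suppose ũ = (ũ_1,…,ũ_K), with each ũ_i : [0,∞) × [0,T] → ℝ continuous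 and ũ_1(0,t) = ⋯ = ũ_K(0,t) =: ũ(0,t), is an A-flux-limited solution: (a) each ũ_i is a viscosity solution of ∂_t ũ_i + H̃_i(∂_x ũ_i) = 0 in (0,∞) × (0,T]; (b) for every t_0 ∈ (0,T] and every (p_1,…,p_K,a) ∈ J⁺ũ(0,t_0), a + max(A, max_i H̃_i^-(p_i)) ≤ 0; and (c) for every (q_1,…,q_K,b) ∈ J⁻ũ(0,t_0), b + max(A, max_i H̃_i^-(q_i)) ≥ 0. Then ũ is a generalized viscosity solution of the Kirchhoff junction problem with B := −Σ_{i=1}^K p_i^A; that is, in addition to (a), for every t_0 ∈ (0,T]: for every (p_1,…,p_K,a) ∈ J⁺ũ(0,t_0), min(−Σ_{i=1}^K p_i − B, min_i (a + H̃_i(p_i))) ≤ 0, and for every (q_1,…,q_K,b) ∈ J⁻ũ(0,t_0), max(−Σ_{i=1}^K q_i − B, max_i (b + H̃_i(q_i))) ≥ 0. -/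
open Set Filter

/-- The (branchwise) space-time domain of the junction problem on branches that are
copies of `[0,∞)`, with time ranging over `[0,T]`. -/
def PDom (T : ℝ) : Set (ℝ × ℝ) := {q : ℝ × ℝ | 0 ≤ q.1 ∧ q.2 ∈ Set.Icc 0 T}

/-- The decreasing truncation `H̃⁻` of a convex Hamiltonian `H̃` with minimum point
`p⁰`: `H̃⁻(p) = H̃(p)` for `p ≤ p⁰` and `H̃⁻(p) = H̃(p⁰)` for `p ≥ p⁰`. -/
noncomputable def Hminus (H : ℝ → ℝ) (p0 : ℝ) (p : ℝ) : ℝ :=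
  if p ≤ p0 then H p else H p0

/-- `(p₁,…,p_K, a)` belongs to the superjet `J⁺ũ(0,t₀)` at the junction point of
branches that are copies of `[0,∞)`: for every branch `i`,
`ũ_i(x,t) ≤ ũ_i(0,t₀) + p_i x + a(t−t₀) + o(x + |t−t₀|)` as `(x,t) → (0,t₀)`
in `[0,∞) × [0,T]`. -/
def RSuperjet (K : ℕ) (T : ℝ) (u : Fin K → ℝ → ℝ → ℝ) (t₀ : ℝ)
    (p : Fin K → ℝ) (a : ℝ) : Prop :=
  ∀ i : Fin K, ∀ ε > (0 : ℝ), ∃ δ > (0 : ℝ), ∀ x t : ℝ, 0 ≤ x → t ∈ Set.Icc 0 T →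
    x + |t - t₀| < δ →
    u i x t ≤ u i 0 t₀ + p i * x + a * (t - t₀) + ε * (x + |t - t₀|)

/-- `(q₁,…,q_K, b)` belongs to the subjet `J⁻ũ(0,t₀)` at the junction point. -/
def RSubjet (K : ℕ) (T : ℝ) (u : Fin K → ℝ → ℝ → ℝ) (t₀ : ℝ)
    (q : Fin K → ℝ) (b : ℝ) : Prop :=
  ∀ i : Fin K, ∀ ε > (0 : ℝ), ∃ δ > (0 : ℝ), ∀ x t : ℝ, 0 ≤ x → t ∈ Set.Icc 0 T →
    x + |t - t₀| < δ →
    u i x t ≥ u i 0 t₀ + q i * x + b * (t - t₀) - ε * (x + |t - t₀|)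

/-- `w` is a viscosity subsolution of `∂ₜw + H(∂ₓw) = 0` in `(0,∞) × (0,T]`. -/
def RViscSub (T : ℝ) (H : ℝ → ℝ) (w : ℝ → ℝ → ℝ) : Prop :=
  ∀ (φ : ℝ × ℝ → ℝ) (x₀ t₀ : ℝ), 0 < x₀ → 0 < t₀ → t₀ ≤ T → ContDiff ℝ 1 φ →
    (∀ᶠ q in nhdsWithin (x₀, t₀) (PDom T), w q.1 q.2 - φ q ≤ w x₀ t₀ - φ (x₀, t₀)) →
    fderiv ℝ φ (x₀, t₀) ((0 : ℝ), (1 : ℝ)) +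
      H (fderiv ℝ φ (x₀, t₀) ((1 : ℝ), (0 : ℝ))) ≤ 0

/-- `w` is a viscosity supersolution of `∂ₜw + H(∂ₓw) = 0` in `(0,∞) × (0,T]`. -/
def RViscSuper (T : ℝ) (H : ℝ → ℝ) (w : ℝ → ℝ → ℝ) : Prop :=
  ∀ (φ : ℝ × ℝ → ℝ) (x₀ t₀ : ℝ), 0 < x₀ → 0 < t₀ → t₀ ≤ T → ContDiff ℝ 1 φ →
    (∀ᶠ q in nhdsWithin (x₀, t₀) (PDom T), w q.1 q.2 - φ q ≥ w x₀ t₀ - φ (x₀, t₀)) →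
    fderiv ℝ φ (x₀, t₀) ((0 : ℝ), (1 : ℝ)) +
      H (fderiv ℝ φ (x₀, t₀) ((1 : ℝ), (0 : ℝ))) ≥ 0

/-- A convex function on `ℝ` is nondecreasing to the right of a minimum point. -/
theorem ConvexOn.le_of_isMin_le {H : ℝ → ℝ} (hH : ConvexOn ℝ Set.univ H) {m r s : ℝ}
    (hm : ∀ p, H m ≤ H p) (hmr : m ≤ r) (hrs : r ≤ s) : H r ≤ H s :=
  (hH.le_max_of_mem_Icc (Set.mem_univ m) (Set.mem_univ s) ⟨hmr, hrs⟩).trans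
    (max_le (hm s) le_rfl)

theorem Hminus_le {H : ℝ → ℝ} {m : ℝ} (hm : ∀ p, H m ≤ H p) (p : ℝ) :
    Hminus H m p ≤ H p := by
  unfold Hminus
  split_ifs
  exacts [le_rfl, hm p]

theorem jmin_le {K : ℕ} (hK : 0 < K) (f : Fin K → ℝ) (i : Fin K) : jmin hK f ≤ f i :=
  Finset.inf'_le f (Finset.mem_univ i)

theorem le_jmax {K : ℕ} (hK : 0 < K) (f : Fin K → ℝ) (i : Fin K) : f i ≤ jmax hK f :=
  Finset.le_sup' f (Finset.mem_univ i)

theorem jmax_lt {K : ℕ} (hK : 0 < K) {f : Fin K → ℝ} {c : ℝ} (h : ∀ i, f i < c) :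
    jmax hK f < c :=
  (Finset.sup'_lt_iff _).2 fun i _ => h i

/-- **Flux-limited solutions are generalized Kirchhoff solutions (Proposition 5.1).**
For each `i`, let `H̃_i : ℝ → ℝ` be convex, continuous and coercive with a unique
global minimum point `p_i⁰`, let `A ≥ A₀ = max_i min H̃_i`, and let `p_i^A` be the
unique point in `[p_i⁰, ∞)` with `H̃_i(p_i^A) = A`. If `ũ` is an `A`-flux-limited
solution of the junction problem, then `ũ` is a generalized viscosity solution of the
Kirchhoff junction problem with `B = −Σ_i p_i^A`: in addition to being a viscosity
solution on each branch, at the junction its superjets satisfy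
`min(−Σ_i p_i − B, min_i (a + H̃_i(p_i))) ≤ 0` and its subjets satisfy
`max(−Σ_i q_i − B, max_i (b + H̃_i(q_i))) ≥ 0`. -/
theorem flux_limited_is_kirchhoff
    (K : ℕ) (hK : 0 < K) (T : ℝ) (hT : 0 < T)
    (H : Fin K → ℝ → ℝ)
    (hconv : ∀ i, ConvexOn ℝ Set.univ (H i))
    (hcont : ∀ i, Continuous (H i))
    (hcoer : ∀ i, ∀ M : ℝ, ∃ R : ℝ, ∀ p : ℝ, R ≤ |p| → M ≤ H i p)
    (p0 : Fin K → ℝ)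
    (hmin : ∀ i p, H i (p0 i) ≤ H i p)
    (huniq : ∀ i p, H i p = H i (p0 i) → p = p0 i)
    (A : ℝ) (hA : jmax hK (fun i => H i (p0 i)) ≤ A)
    (pA : Fin K → ℝ) (hpA1 : ∀ i, p0 i ≤ pA i) (hpA2 : ∀ i, H i (pA i) = A)
    (hpAuniq : ∀ i r, p0 i ≤ r → H i r = A → r = pA i)
    (B : ℝ) (hB : B = -∑ i, pA i)
    -- the flux-limited solution: continuous on each branch, single-valued at the junction
    (ut : Fin K → ℝ → ℝ → ℝ)
    (hutcont : ∀ i, ContinuousOn (fun q : ℝ × ℝ => ut i q.1 q.2) (PDom T))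
    (hjct : ∀ i j : Fin K, ∀ t ∈ Set.Icc (0 : ℝ) T, ut i 0 t = ut j 0 t)
    -- (a) each `ũ_i` is a viscosity solution in the interior of its branch
    (hsub : ∀ i, RViscSub T (H i) (ut i))
    (hsuper : ∀ i, RViscSuper T (H i) (ut i))
    -- (b) the flux-limited condition for superjets at the junction
    (hfluxsub : ∀ t₀ ∈ Set.Ioc (0 : ℝ) T, ∀ (p : Fin K → ℝ) (a : ℝ),
      RSuperjet K T ut t₀ p a →
      a + max A (jmax hK fun i => Hminus (H i) (p0 i) (p i)) ≤ 0)
    -- (c) the flux-limited condition for subjets at the junction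
    (hfluxsuper : ∀ t₀ ∈ Set.Ioc (0 : ℝ) T, ∀ (q : Fin K → ℝ) (b : ℝ),
      RSubjet K T ut t₀ q b →
      b + max A (jmax hK fun i => Hminus (H i) (p0 i) (q i)) ≥ 0) :
    (∀ i, RViscSub T (H i) (ut i)) ∧ (∀ i, RViscSuper T (H i) (ut i)) ∧
    (∀ t₀ ∈ Set.Ioc (0 : ℝ) T,
      (∀ (p : Fin K → ℝ) (a : ℝ), RSuperjet K T ut t₀ p a →
        min (-(∑ i, p i) - B) (jmin hK fun i => a + H i (p i)) ≤ 0) ∧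
      (∀ (q : Fin K → ℝ) (b : ℝ), RSubjet K T ut t₀ q b →
        max (-(∑ i, q i) - B) (jmax hK fun i => b + H i (q i)) ≥ 0)) := by
  refine ⟨hsub, hsuper, fun t₀ ht₀ => ⟨fun p a hp => ?_, fun q b hq => ?_⟩⟩
  · have hflux := hfluxsub t₀ ht₀ p a hp
    by_contra! hpos
    obtain ⟨hsum, hall⟩ := lt_min_iff.1 hpos
    have hlt : ∑ i, p i < ∑ i, pA i := by linarith
    obtain ⟨i, -, hi⟩ := Finset.exists_lt_of_sum_lt hlt
    have hHi : 0 < a + H i (p i) := hall.trans_le (jmin_le hK _ i)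
    have haA := le_max_left A (jmax hK fun i => Hminus (H i) (p0 i) (p i))
    have haM := (le_jmax hK (fun i => Hminus (H i) (p0 i) (p i)) i).trans (le_max_right A _)
    rcases le_total (p i) (p0 i) with h | h
    · have hH : Hminus (H i) (p0 i) (p i) = H i (p i) := if_pos h
      linarith
    · have := (hconv i).le_of_isMin_le (hmin i) h hi.le
      rw [hpA2] at this
      linarith
  · have hflux := hfluxsuper t₀ ht₀ q b hq
    by_contra! hneg
    obtain ⟨hsum, hall⟩ := max_lt_iff.1 hneg
    have hH : ∀ i, H i (q i) < -b := fun i => by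
      linarith [le_jmax hK (fun i => b + H i (q i)) i]
    have hM : jmax hK (fun i => Hminus (H i) (p0 i) (q i)) < -b :=
      jmax_lt hK fun i => (Hminus_le (hmin i) (q i)).trans_lt (hH i)
    have hbA : -b ≤ A := by
      by_contra! hlt
      linarith [max_lt hlt hM]
    have hq_le : ∀ i, q i ≤ pA i := fun i => by
      by_contra! hlt
      have := (hconv i).le_of_isMin_le (hmin i) (hpA1 i) hlt.le
      rw [hpA2] at this
      linarith [hH i]
    linarith [Finset.sum_le_sum fun i (_ : i ∈ Finset.univ) => hq_le i]
end

section
/- Subsolution step for flux limiters: fix an integer K ≥ 1. For each i ∈ {1,…,K}, let H̃_i : ℝ → ℝ be convex and continuous with a unique global minimum point p_i^0, define H̃_i^-(p) = H̃_i(p) for p ≤ p_i^0 and H̃_i^-(p) = H̃_i(p_i^0) for p ≥ p_i^0, let A ≥ H̃_i(p_i^0) for all i, and let p_i^A ∈ [p_i^0, ∞) satisfy H̃_i(p_i^A) = A. Let a ∈ ℝ and p_1,…,p_K ∈ ℝ satisfy a + A ≤ 0 and a + H̃_i^-(p_i) ≤ 0 for every i, and suppose −Σ_{i=1}^K p_i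 + Σ_{i=1}^K p_i^A > 0. Then there exists i_0 ∈ {1,…,K} with a + H̃_{i_0}(p_{i_0}) ≤ 0. -/
/-- **Subsolution step for flux limiters.**
For each `i` let `H̃_i` be convex continuous with unique global minimum point `p_i⁰`,
let `A ≥ H̃_i(p_i⁰)` for all `i` and `p_i^A ∈ [p_i⁰, ∞)` with `H̃_i(p_i^A) = A`. If
`a + A ≤ 0`, `a + H̃_i⁻(p_i) ≤ 0` for all `i`, and `−Σ_i p_i + Σ_i p_i^A > 0`, then
there is `i₀` with `a + H̃_{i₀}(p_{i₀}) ≤ 0`. -/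
theorem flux_limiter_subsolution_step
    (K : ℕ) (hK : 0 < K) (H : Fin K → ℝ → ℝ)
    (hconv : ∀ i, ConvexOn ℝ Set.univ (H i))
    (hcont : ∀ i, Continuous (H i))
    (p0 : Fin K → ℝ)
    (hmin : ∀ i p, H i (p0 i) ≤ H i p)
    (huniq : ∀ i p, H i p = H i (p0 i) → p = p0 i)
    (A : ℝ) (hA : ∀ i, H i (p0 i) ≤ A)
    (pA : Fin K → ℝ) (hpA1 : ∀ i, p0 i ≤ pA i) (hpA2 : ∀ i, H i (pA i) = A)
    (a : ℝ) (p : Fin K → ℝ)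
    (haA : a + A ≤ 0)
    (hap : ∀ i, a + Hminus (H i) (p0 i) (p i) ≤ 0)
    (hsum : 0 < -∑ i, p i + ∑ i, pA i) :
    ∃ i₀ : Fin K, a + H i₀ (p i₀) ≤ 0 := by
  obtain ⟨i, -, hi⟩ := Finset.exists_lt_of_sum_lt (show ∑ i, p i < ∑ i, pA i by linarith)
  refine ⟨i, ?_⟩
  by_cases h : p i ≤ p0 i
  · simpa [Hminus, h] using hap i
  · have hle := (hconv i).le_max_of_mem_Icc (Set.mem_univ (p0 i)) (Set.mem_univ (pA i))
      ⟨(not_le.mp h).le, hi.le⟩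
    rw [hpA2 i, max_eq_right (hA i)] at hle
    linarith
end
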